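/- arXiv:1001.0612 — 2 statements merged into one kernel-verified Lean document; each statement's English description precedes it below -/
import Mathlib

section
/- Let n = 2m+1 ≥ 7 be odd, let V be the number of bulbs on at the terminal time under the equal mixture (weight 1/4 each, over (a,b) ∈ {0,1}²) of lightbulb processes on n bulbs with switch pattern 𝐧(a,b) = (1,…,m−1, m+a, m+b, m+2,…,n) and all bulbs initially off, and let σ_V² = (n/4)(1 − λ̄_{n,2,𝐧}) + (n²/4)·λ̄_{n,2,𝐧} with 𝐧 = (1,…,n). Then sup over z ∈ ℝ of |P((V − n/2)/σ_V ≤ z) − P(Z ≤ z)| ≤ (n/(2σ_V²))·Δ̄₁ + 1.64·n/σ_V³ + 2/σ_V, where Z is a standard normal random variable and Δ̄₁ = 1/√n + (1/(2√2))e^{−n/4}. -/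
open MeasureTheory ProbabilityTheory Finset

/-- `λ_{n,b,s} = ∑_{t=0}^{b} C(b,t) (−2)^t (s)_t/(n)_t`. -/
noncomputable def lam (n b s : ℕ) : ℝ :=
  ∑ t ∈ Finset.range (b + 1),
    (b.choose t : ℝ) * (-2 : ℝ) ^ t * (s.descFactorial t : ℝ) / (n.descFactorial t : ℝ)

/-- `λ̄_{n,b,𝐧}` for the full pattern `𝐧 = (1,…,n)` with `n = 2m+1` odd: the two factors
`λ_{n,b,m}` and `λ_{n,b,m+1}` in the product are both replaced by their average. -/
noncomputable def lamBarFull (n b m : ℕ) : ℝ :=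
  (∏ r ∈ Finset.Icc 1 n \ {m, m + 1}, lam n b r) * ((lam n b m + lam n b (m + 1)) / 2) ^ 2

/-- The arrays of switch variables having exactly `s r` switches in stage `r`. -/
def validArrays (n k : ℕ) (s : Fin k → ℕ) : Finset (Fin k → Fin n → Bool) :=
  Finset.univ.filter (fun e => ∀ r, (Finset.univ.filter (fun j => e r j = true)).card = s r)

/-- Terminal state of bulb `j` (all bulbs initially off). -/
def bulbOn {n k : ℕ} (e : Fin k → Fin n → Bool) (j : Fin n) : Bool :=
  decide ((Finset.univ.filter (fun r => e r j = true)).card % 2 = 1)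

/-- Number of bulbs on at the terminal time. -/
def numOn {n k : ℕ} (e : Fin k → Fin n → Bool) : ℕ :=
  (Finset.univ.filter (fun j => bulbOn e j = true)).card

/-- The switch pattern `𝐧(a,b) = (1,…,m−1, m+a, m+b, m+2,…,n)` for `n = 2m+1` odd. -/
def oddPattern (n m a b : ℕ) : Fin n → ℕ := fun r =>
  if (r : ℕ) + 1 = m then m + a
  else if (r : ℕ) + 1 = m + 1 then m + b
  else (r : ℕ) + 1

/-- The standard normal distribution function. -/
noncomputable def normalCDF (x : ℝ) : ℝ := ((gaussianReal 0 1) (Set.Iic x)).toReal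

/-- The standard normal density. -/
noncomputable def normalPDF (x : ℝ) : ℝ := (√(2 * Real.pi))⁻¹ * Real.exp (-x ^ 2 / 2)

lemma gaussianPDFReal_eq_normalPDF : gaussianPDFReal 0 1 = normalPDF := by
  funext x
  simp [gaussianPDFReal, normalPDF]

lemma normalPDF_pos (x : ℝ) : 0 < normalPDF x := by
  unfold normalPDF; positivity

lemma hasDerivAt_normalPDF (x : ℝ) : HasDerivAt normalPDF (-x * normalPDF x) x := by
  unfold normalPDF
  have h : HasDerivAt (fun y : ℝ => -y ^ 2 / 2) (-x) x := by
    have := ((hasDerivAt_pow 2 x).neg).div_const 2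
    refine this.congr_deriv ?_
    norm_num; ring
  have := (h.exp).const_mul (√(2 * Real.pi))⁻¹
  refine this.congr_deriv ?_
  ring

lemma continuous_normalPDF : Continuous normalPDF := by
  unfold normalPDF; fun_prop

lemma normalPDF_le_half (x : ℝ) : normalPDF x ≤ 1 / 2 := by
  unfold normalPDF
  have h1 : (2 : ℝ) ≤ √(2 * Real.pi) := by
    apply Real.le_sqrt_of_sq_le; nlinarith [Real.pi_gt_three]
  have h2 : Real.exp (-x ^ 2 / 2) ≤ 1 := by
    apply Real.exp_le_one_iff.2; nlinarith [sq_nonneg x]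
  calc _ ≤ (2 : ℝ)⁻¹ * 1 := by gcongr
    _ = 1 / 2 := by norm_num

lemma normalPDF_neg (x : ℝ) : normalPDF (-x) = normalPDF x := by simp [normalPDF]

lemma integrable_normalPDF : Integrable normalPDF := by
  rw [← gaussianPDFReal_eq_normalPDF]; exact integrable_gaussianPDFReal 0 1

lemma integral_normalPDF : ∫ x, normalPDF x = 1 := by
  rw [← gaussianPDFReal_eq_normalPDF]; exact integral_gaussianPDFReal_eq_one 0 one_ne_zero

lemma normalCDF_eq_integral (x : ℝ) : normalCDF x = ∫ t in Set.Iic x, normalPDF t := by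
  rw [normalCDF, gaussianReal_apply_eq_integral 0 one_ne_zero, ← gaussianPDFReal_eq_normalPDF]
  exact ENNReal.toReal_ofReal (integral_nonneg fun _ => gaussianPDFReal_nonneg _ _ _)

lemma one_sub_normalCDF_eq_integral (x : ℝ) : 1 - normalCDF x = ∫ t in Set.Ioi x, normalPDF t := by
  rw [normalCDF_eq_integral, ← integral_normalPDF,
    ← intervalIntegral.integral_Iic_add_Ioi integrable_normalPDF.integrableOn
      integrable_normalPDF.integrableOn (b := x)]
  ring

lemma normalCDF_sub (x y : ℝ) : normalCDF y - normalCDF x = ∫ t in x..y, normalPDF t := by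
  rw [normalCDF_eq_integral, normalCDF_eq_integral]
  exact intervalIntegral.integral_Iic_sub_Iic integrable_normalPDF.integrableOn
    integrable_normalPDF.integrableOn

lemma hasDerivAt_normalCDF (x : ℝ) : HasDerivAt normalCDF (normalPDF x) x := by
  have h : normalCDF = fun y => normalCDF 0 + ∫ t in (0 : ℝ)..y, normalPDF t := by
    funext y; rw [← normalCDF_sub]; ring
  rw [h]
  exact (intervalIntegral.integral_hasDerivAt_right
    (continuous_normalPDF.intervalIntegrable _ _)
    (continuous_normalPDF.stronglyMeasurableAtFilter _ _)
    continuous_normalPDF.continuousAt).const_add _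

lemma continuous_normalCDF : Continuous normalCDF :=
  continuous_iff_continuousAt.2 fun x => (hasDerivAt_normalCDF x).continuousAt

lemma normalCDF_mono : Monotone normalCDF :=
  monotone_of_deriv_nonneg (fun x => (hasDerivAt_normalCDF x).differentiableAt)
    fun x => by rw [(hasDerivAt_normalCDF x).deriv]; exact (normalPDF_pos x).le

lemma normalCDF_nonneg (x : ℝ) : 0 ≤ normalCDF x := ENNReal.toReal_nonneg

lemma normalCDF_le_one (x : ℝ) : normalCDF x ≤ 1 := by
  have : 0 ≤ 1 - normalCDF x := by
    rw [one_sub_normalCDF_eq_integral]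
    exact integral_nonneg fun t => (normalPDF_pos t).le
  linarith

lemma normalCDF_neg (x : ℝ) : normalCDF (-x) = 1 - normalCDF x := by
  rw [one_sub_normalCDF_eq_integral, normalCDF_eq_integral]
  have := integral_comp_neg_Iic (-x) normalPDF
  simp only [normalPDF_neg, neg_neg] at this
  exact this

lemma normalCDF_zero : normalCDF 0 = 1 / 2 := by
  have := normalCDF_neg 0
  rw [neg_zero] at this; linarith

lemma normalCDF_add_le (x : ℝ) {h : ℝ} (hh : 0 ≤ h) :
    normalCDF (x + h) ≤ normalCDF x + h / 2 := by
  have := Convex.image_sub_le_mul_sub_of_deriv_le (f := normalCDF) (C := 1 / 2) convex_univ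
    continuous_normalCDF.continuousOn
    (fun y _ => (hasDerivAt_normalCDF y).differentiableAt.differentiableWithinAt)
    (fun y _ => by rw [(hasDerivAt_normalCDF y).deriv]; exact normalPDF_le_half y)
    x (Set.mem_univ _) (x + h) (Set.mem_univ _) (by linarith)
  linarith

/-- Gaussian tail bound (Mills ratio). -/
lemma mul_one_sub_normalCDF_le (x : ℝ) : x * (1 - normalCDF x) ≤ normalPDF x := by
  have htop : Filter.Tendsto (fun t => -normalPDF t) Filter.atTop (nhds 0) := by
    have h2 : Filter.Tendsto (fun t : ℝ => -t ^ 2 / 2) Filter.atTop Filter.atBot := by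
      have h3 : Filter.Tendsto (fun t : ℝ => t ^ 2 / 2) Filter.atTop Filter.atTop :=
        (Filter.tendsto_pow_atTop two_ne_zero).atTop_div_const two_pos
      refine (Filter.tendsto_neg_atTop_atBot.comp h3).congr fun t => ?_
      simp only [Function.comp]; ring
    have := ((Real.tendsto_exp_atBot.comp h2).const_mul (√(2 * Real.pi))⁻¹).neg
    simpa [normalPDF] using this
  rcases le_or_gt x 0 with hx | hx
  · have := normalCDF_le_one x
    have := normalPDF_pos x
    nlinarith
  have hd : ∀ t : ℝ, HasDerivAt (fun t => -normalPDF t) (t * normalPDF t) t := fun t =>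
    (hasDerivAt_normalPDF t).neg.congr_deriv (by ring)
  have hpos : ∀ t ∈ Set.Ioi x, 0 ≤ t * normalPDF t := fun t ht =>
    mul_nonneg (hx.le.trans (le_of_lt ht)) (normalPDF_pos t).le
  have h_integrable : IntegrableOn (fun t => t * normalPDF t) (Set.Ioi x) :=
    integrableOn_Ioi_deriv_of_nonneg' (fun t _ => hd t) hpos htop
  have heq : ∫ t in Set.Ioi x, t * normalPDF t = normalPDF x := by
    rw [integral_Ioi_of_hasDerivAt_of_tendsto' (fun t _ => hd t) h_integrable htop]; ring
  rw [one_sub_normalCDF_eq_integral, ← integral_const_mul, ← heq]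
  refine setIntegral_mono_on (integrable_normalPDF.integrableOn.const_mul x) h_integrable
    measurableSet_Ioi fun t ht => ?_
  exact mul_le_mul_of_nonneg_right (le_of_lt ht) (normalPDF_pos t).le

lemma one_sub_normalCDF_le {x : ℝ} (hx : 0 ≤ x) : 1 - normalCDF x ≤ 3 / 2 * normalPDF x := by
  have hd : ∀ t : ℝ, HasDerivAt (fun t => (1 - normalCDF t) / normalPDF t)
      ((t * (1 - normalCDF t) - normalPDF t) / normalPDF t) t := fun t => by
    have := ((hasDerivAt_normalCDF t).const_sub 1).div (hasDerivAt_normalPDF t)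
      (normalPDF_pos t).ne'
    refine this.congr_deriv ?_
    have := (normalPDF_pos t).ne'
    field_simp; ring
  have hanti : Antitone fun t => (1 - normalCDF t) / normalPDF t :=
    antitone_of_deriv_nonpos (fun t => (hd t).differentiableAt) fun t => by
      rw [(hd t).deriv]
      exact div_nonpos_of_nonpos_of_nonneg (by linarith [mul_one_sub_normalCDF_le t])
        (normalPDF_pos t).le
  have h0 : (1 - normalCDF 0) / normalPDF 0 ≤ 3 / 2 := by
    rw [div_le_iff₀ (normalPDF_pos 0), normalCDF_zero, normalPDF]
    have h1 : √(2 * Real.pi) ≤ 3 := by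
      apply Real.sqrt_le_iff.2; constructor <;> nlinarith [Real.pi_lt_d2]
    have h2 : (3 : ℝ)⁻¹ ≤ (√(2 * Real.pi))⁻¹ := by gcongr
    simp only [ne_eq, OfNat.ofNat_ne_zero, not_false_eq_true, zero_pow, neg_zero, zero_div,
      Real.exp_zero, mul_one]
    linarith
  have := (hanti hx).trans h0
  exact (div_le_iff₀ (normalPDF_pos x)).1 this

/-- The bounded solution of the Stein equation for the half line `(-∞, z]`. -/
noncomputable def steinSol (z w : ℝ) : ℝ :=
  if w ≤ z then normalCDF w * (1 - normalCDF z) / normalPDF w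
  else normalCDF z * (1 - normalCDF w) / normalPDF w

lemma steinSol_bounds (z w : ℝ) : |steinSol z w| ≤ 3 / 2 ∧ |w * steinSol z w| ≤ 1 := by
  obtain ⟨N, hN, hN0, hN1, hN2⟩ : ∃ N, steinSol z w = N / normalPDF w ∧ 0 ≤ N ∧
      N ≤ normalCDF w ∧ N ≤ 1 - normalCDF w := by
    have h1 := normalCDF_nonneg w
    have h2 := normalCDF_le_one w
    have h3 := normalCDF_nonneg z
    have h4 := normalCDF_le_one z
    unfold steinSol
    split_ifs with h
    · have := normalCDF_mono h
      exact ⟨_, rfl, by nlinarith, by nlinarith, by nlinarith⟩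
    · have := normalCDF_mono (not_le.1 h).le
      exact ⟨_, rfl, by nlinarith, by nlinarith, by nlinarith⟩
  have hp := normalPDF_pos w
  rw [hN, ← mul_div_assoc, abs_div, abs_div, abs_mul, abs_of_nonneg hN0, abs_of_pos hp,
    div_le_iff₀ hp, div_le_iff₀ hp]
  rcases le_total 0 w with hw | hw
  · rw [abs_of_nonneg hw]
    have h1 := one_sub_normalCDF_le hw
    have h2 := mul_one_sub_normalCDF_le w
    exact ⟨by linarith, by nlinarith⟩
  · rw [abs_of_nonpos hw]
    have h1 := one_sub_normalCDF_le (neg_nonneg.2 hw)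
    have h2 := mul_one_sub_normalCDF_le (-w)
    rw [normalCDF_neg, normalPDF_neg] at h1 h2
    exact ⟨by linarith, by nlinarith⟩

lemma continuous_steinSol (z : ℝ) : Continuous (steinSol z) := by
  unfold steinSol
  refine Continuous.if_le ?_ ?_ continuous_id continuous_const ?_
  · exact (continuous_normalCDF.mul continuous_const).div continuous_normalPDF
      fun w => (normalPDF_pos w).ne'
  · exact (continuous_const.mul (continuous_const.sub continuous_normalCDF)).div
      continuous_normalPDF fun w => (normalPDF_pos w).ne'
  · rintro w rfl; rfl

lemma hasDerivAt_steinSol {z w : ℝ} (h : w ≠ z) :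
    HasDerivAt (steinSol z)
      (w * steinSol z w + (if w ≤ z then 1 else 0) - normalCDF z) w := by
  have hp := (normalPDF_pos w).ne'
  rcases lt_or_gt_of_ne h with h | h
  · have h1 := ((hasDerivAt_normalCDF w).mul_const (1 - normalCDF z)).div
      (hasDerivAt_normalPDF w) hp
    refine (h1.congr_of_eventuallyEq ?_).congr_deriv ?_
    · filter_upwards [Iio_mem_nhds h] with t ht
      simp [steinSol, le_of_lt (Set.mem_Iio.1 ht)]
    · simp only [steinSol, h.le, if_true]
      field_simp; ring
  · have h1 := (((hasDerivAt_normalCDF w).const_sub 1).const_mul (normalCDF z)).div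
      (hasDerivAt_normalPDF w) hp
    refine (h1.congr_of_eventuallyEq ?_).congr_deriv ?_
    · filter_upwards [Ioi_mem_nhds h] with t ht
      simp [steinSol, not_le.2 (Set.mem_Ioi.1 ht)]
    · simp only [steinSol, not_le.2 h, if_false]
      field_simp; ring

lemma sub_le_mul_of_hasDerivAt_ne {f d : ℝ → ℝ} {a b z C : ℝ} (hf : Continuous f)
    (hd : ∀ w, w ≠ z → HasDerivAt f (d w) w) (hab : a ≤ b)
    (hC : ∀ w, a < w → w < b → w ≠ z → d w ≤ C) : f b - f a ≤ C * (b - a) := by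
  have key : ∀ a' b', a ≤ a' → a' ≤ b' → b' ≤ b → (∀ w, a' < w → w < b' → w ≠ z) →
      f b' - f a' ≤ C * (b' - a') := by
    intro a' b' h1 h2 h3 h4
    refine Convex.image_sub_le_mul_sub_of_deriv_le (convex_Icc a' b') hf.continuousOn ?_ ?_ a'
      (Set.left_mem_Icc.2 h2) b' (Set.right_mem_Icc.2 h2) h2
    · rw [interior_Icc]
      exact fun w hw => (hd w (h4 w hw.1 hw.2)).differentiableAt.differentiableWithinAt
    · rw [interior_Icc]
      intro w hw
      rw [(hd w (h4 w hw.1 hw.2)).deriv]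
      exact hC w (h1.trans_lt hw.1) (hw.2.trans_le h3) (h4 w hw.1 hw.2)
  by_cases h : a < z ∧ z < b
  · have h1 := key a z le_rfl h.1.le h.2.le fun w _ hw => hw.ne
    have h2 := key z b h.1.le h.2.le le_rfl fun w hw _ => hw.ne'
    linarith
  · exact key a b le_rfl hab le_rfl fun w h1 h2 h3 => h ⟨h3 ▸ h1, h3 ▸ h2⟩

lemma mul_le_sub_of_hasDerivAt_ne {f d : ℝ → ℝ} {a b z C : ℝ} (hf : Continuous f)
    (hd : ∀ w, w ≠ z → HasDerivAt f (d w) w) (hab : a ≤ b)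
    (hC : ∀ w, a < w → w < b → w ≠ z → C ≤ d w) : C * (b - a) ≤ f b - f a := by
  have := sub_le_mul_of_hasDerivAt_ne (f := fun x => -f x) (d := fun x => -d x) (C := -C) hf.neg
    (fun w hw => (hd w hw).neg) hab fun w h1 h2 h3 => neg_le_neg (hC w h1 h2 h3)
  linarith

lemma steinSol_lipschitz (z a b : ℝ) : |steinSol z b - steinSol z a| ≤ 2 * |b - a| := by
  wlog hab : a ≤ b generalizing a b
  · rw [abs_sub_comm, abs_sub_comm b a]; exact this b a (le_of_not_ge hab)
  have hd : ∀ w, |w * steinSol z w + (if w ≤ z then 1 else 0) - normalCDF z| ≤ 2 := by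
    intro w
    have h1 := abs_le.1 (steinSol_bounds z w).2
    have h2 := normalCDF_nonneg z
    have h3 := normalCDF_le_one z
    rw [abs_le]
    split_ifs <;> constructor <;> linarith
  rw [abs_of_nonneg (sub_nonneg.2 hab), abs_le]
  constructor
  · have := mul_le_sub_of_hasDerivAt_ne (continuous_steinSol z)
      (fun w hw => hasDerivAt_steinSol hw) hab fun w _ _ _ => (abs_le.1 (hd w)).1
    linarith
  · exact sub_le_mul_of_hasDerivAt_ne (continuous_steinSol z)
      (fun w hw => hasDerivAt_steinSol hw) hab fun w _ _ _ => (abs_le.1 (hd w)).2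

lemma mul_steinSol_sub_le (z a w : ℝ) :
    |w * steinSol z w - a * steinSol z a| ≤ |w - a| * (2 * |a| + 3 / 2) := by
  have h1 := steinSol_lipschitz z a w
  have h2 := (steinSol_bounds z w).1
  calc |w * steinSol z w - a * steinSol z a|
      = |a * (steinSol z w - steinSol z a) + (w - a) * steinSol z w| := by congr 1; ring
    _ ≤ |a| * |steinSol z w - steinSol z a| + |w - a| * |steinSol z w| := by
      rw [← abs_mul, ← abs_mul]; exact abs_add_le _ _
    _ ≤ |a| * (2 * |w - a|) + |w - a| * (3 / 2) := by gcongr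
    _ = _ := by ring

lemma abs_mul_steinSol_sub_average_le {z a b w : ℝ} (ha : a ≤ w) (hb : w ≤ b) :
    |w * steinSol z w - (a * steinSol z a + b * steinSol z b) / 2|
      ≤ (b - a) * (|a| + |b| + 3 / 2) := by
  have h1 := mul_steinSol_sub_le z a w
  have h2 := mul_steinSol_sub_le z b w
  rw [abs_of_nonneg (sub_nonneg.2 ha)] at h1
  rw [abs_of_nonpos (sub_nonpos.2 hb)] at h2
  have h3 : (w - a) * (2 * |a| + 3 / 2) ≤ (b - a) * (2 * |a| + 3 / 2) := by gcongr
  have h4 : -(w - b) * (2 * |b| + 3 / 2) ≤ (b - a) * (2 * |b| + 3 / 2) := by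
    gcongr; linarith
  have h5 := abs_le.1 (h1.trans h3)
  have h6 := abs_le.1 (h2.trans h4)
  rw [abs_le]
  constructor <;> linarith [h5.1, h5.2, h6.1, h6.2]

lemma steinSol_sub_le {z a b : ℝ} (hab : a ≤ b) :
    steinSol z b - steinSol z a ≤
      ((a * steinSol z a + b * steinSol z b) / 2 + (b - a) * (|a| + |b| + 3 / 2)
        + (if a ≤ z then 1 else 0) - normalCDF z) * (b - a) := by
  refine sub_le_mul_of_hasDerivAt_ne (continuous_steinSol z)
    (fun w hw => hasDerivAt_steinSol hw) hab fun w h1 h2 _ => ?_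
  have := (abs_le.1 (abs_mul_steinSol_sub_average_le (z := z) h1.le h2.le)).2
  have h3 : (if w ≤ z then (1 : ℝ) else 0) ≤ if a ≤ z then 1 else 0 := by
    split_ifs <;> linarith
  linarith

lemma le_steinSol_sub {z a b : ℝ} (hab : a ≤ b) :
    ((a * steinSol z a + b * steinSol z b) / 2 - (b - a) * (|a| + |b| + 3 / 2)
        + (if b ≤ z then 1 else 0) - normalCDF z) * (b - a) ≤
      steinSol z b - steinSol z a := by
  refine mul_le_sub_of_hasDerivAt_ne (continuous_steinSol z)
    (fun w hw => hasDerivAt_steinSol hw) hab fun w h1 h2 _ => ?_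
  have := (abs_le.1 (abs_mul_steinSol_sub_average_le (z := z) h1.le h2.le)).1
  have h3 : (if b ≤ z then (1 : ℝ) else 0) ≤ if w ≤ z then 1 else 0 := by
    split_ifs <;> linarith
  linarith

lemma sum_choose_succ_mul (N : ℕ) (G : ℕ → ℝ) :
    ∑ k ∈ range (N + 2), ((N + 1).choose k : ℝ) * G k
      = ∑ j ∈ range (N + 1), (N.choose j : ℝ) * (G j + G (j + 1)) := by
  rw [sum_range_succ']
  simp only [Nat.choose_succ_succ', Nat.cast_add, add_mul, mul_add, sum_add_distrib,
    Nat.choose_zero_right, Nat.cast_one, one_mul]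
  rw [sum_range_succ (fun x => (N.choose (x + 1) : ℝ) * G (x + 1)) N, Nat.choose_succ_self,
    sum_range_succ' (fun x => (N.choose x : ℝ) * G x) N]
  simp
  ring

lemma sum_choose_succ_mul_centered (N : ℕ) (g : ℕ → ℝ) :
    ∑ k ∈ range (N + 2), ((N + 1).choose k : ℝ) * ((2 * k - (N + 1 : ℕ)) * g k)
      = (N + 1 : ℕ) * ∑ j ∈ range (N + 1), (N.choose j : ℝ) * (g (j + 1) - g j) := by
  have h1 : ∑ k ∈ range (N + 2), ((N + 1).choose k : ℝ) * (k * g k)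
      = (N + 1 : ℕ) * ∑ j ∈ range (N + 1), (N.choose j : ℝ) * g (j + 1) := by
    rw [sum_range_succ', mul_sum]
    simp only [Nat.cast_zero, zero_mul, mul_zero, add_zero]
    refine sum_congr rfl fun j _ => ?_
    have := Nat.add_one_mul_choose_eq N j
    have h : ((N + 1 : ℕ) : ℝ) * N.choose j = (N + 1).choose (j + 1) * (j + 1 : ℕ) := by
      exact_mod_cast this
    rw [← mul_assoc, ← mul_assoc, h]
  have h2 : ∑ k ∈ range (N + 2), ((N + 1).choose k : ℝ) * (((N + 1 : ℕ) - k) * g k)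
      = (N + 1 : ℕ) * ∑ j ∈ range (N + 1), (N.choose j : ℝ) * g j := by
    rw [sum_range_succ, mul_sum]
    simp only [sub_self, zero_mul, mul_zero, add_zero]
    refine sum_congr rfl fun j hj => ?_
    have := Nat.choose_mul_succ_eq N j
    have hj' : j ≤ N + 1 := (mem_range.1 hj).le
    have h : (N.choose j : ℝ) * ((N + 1 : ℕ) : ℝ) = (N + 1).choose j * ((N + 1 : ℕ) - j) := by
      rw [← Nat.cast_sub hj']; exact_mod_cast this
    rw [← mul_assoc, ← mul_assoc, ← h]; ring
  have h3 : ∑ k ∈ range (N + 2), ((N + 1).choose k : ℝ) * ((2 * k - (N + 1 : ℕ)) * g k)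
      = ∑ k ∈ range (N + 2), ((N + 1).choose k : ℝ) * (k * g k)
        - ∑ k ∈ range (N + 2), ((N + 1).choose k : ℝ) * (((N + 1 : ℕ) - k) * g k) := by
    rw [← sum_sub_distrib]
    exact sum_congr rfl fun k _ => by ring
  rw [h3, h1, h2, ← mul_sub, ← sum_sub_distrib]
  simp only [mul_sub]

/-- The standardized value `(2k - n) / √n` of a binomial variable with parameters `n`, `1/2`. -/
noncomputable def stdBinom (n k : ℕ) : ℝ := (2 * k - n) / √n

lemma stdBinom_succ (n k : ℕ) : stdBinom n (k + 1) = stdBinom n k + 2 / √n := by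
  unfold stdBinom; push_cast; ring

lemma sum_choose_mul_stdBinom (N : ℕ) (g : ℕ → ℝ) :
    ∑ k ∈ range (N + 2), ((N + 1).choose k : ℝ) * (stdBinom (N + 1) k * g k)
      = √(N + 1 : ℕ) * ∑ j ∈ range (N + 1), (N.choose j : ℝ) * (g (j + 1) - g j) := by
  have hs : √((N + 1 : ℕ) : ℝ) ≠ 0 := by positivity
  have h := sum_choose_succ_mul_centered N g
  nth_rewrite 2 [← Real.mul_self_sqrt (Nat.cast_nonneg (N + 1))] at h
  have h2 : ∑ k ∈ range (N + 2), ((N + 1).choose k : ℝ) * (stdBinom (N + 1) k * g k)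
      = (∑ k ∈ range (N + 2), ((N + 1).choose k : ℝ) * ((2 * k - (N + 1 : ℕ)) * g k))
        / √(N + 1 : ℕ) := by
    rw [sum_div]
    exact sum_congr rfl fun k _ => by unfold stdBinom; ring
  rw [h2, h]
  field_simp

lemma sum_choose_cast (N : ℕ) : ∑ j ∈ range (N + 1), (N.choose j : ℝ) = 2 ^ N := by
  exact_mod_cast Nat.sum_range_choose N

lemma sum_choose_mul_abs_stdBinom_le (N : ℕ) :
    ∑ j ∈ range (N + 1), (N.choose j : ℝ) *
      (|stdBinom (N + 1) j| + |stdBinom (N + 1) (j + 1)|) ≤ 2 * 2 ^ N := by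
  have hs : √((N + 1 : ℕ) : ℝ) ≠ 0 := by positivity
  rw [← sum_choose_succ_mul N fun k => |stdBinom (N + 1) k|]
  have h2 : ∑ k ∈ range (N + 2), ((N + 1).choose k : ℝ) *
      (stdBinom (N + 1) k * stdBinom (N + 1) k) = 2 * 2 ^ N := by
    rw [sum_choose_mul_stdBinom]
    simp only [stdBinom_succ, add_sub_cancel_left]
    rw [← sum_mul, sum_choose_cast]
    field_simp
  have h3 := sum_choose_cast (N + 1)
  calc ∑ k ∈ range (N + 2), ((N + 1).choose k : ℝ) * |stdBinom (N + 1) k|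
      ≤ ∑ k ∈ range (N + 2), ((N + 1).choose k : ℝ) *
        (1 / 2 + (stdBinom (N + 1) k * stdBinom (N + 1) k) / 2) := by
        refine sum_le_sum fun k _ => ?_
        gcongr
        nlinarith [sq_nonneg (|stdBinom (N + 1) k| - 1), abs_mul_abs_self (stdBinom (N + 1) k)]
    _ = 1 / 2 * ∑ k ∈ range (N + 2), ((N + 1).choose k : ℝ)
        + 1 / 2 * ∑ k ∈ range (N + 2), ((N + 1).choose k : ℝ) *
          (stdBinom (N + 1) k * stdBinom (N + 1) k) := by
        rw [mul_sum, mul_sum, ← sum_add_distrib]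
        exact sum_congr rfl fun k _ => by ring
    _ = _ := by rw [h2, h3]; ring

lemma normalCDF_le_sum_choose (N : ℕ) (z : ℝ) :
    2 ^ N * normalCDF z ≤ ∑ j ∈ range (N + 1), (N.choose j : ℝ) *
      (if stdBinom (N + 1) j ≤ z then 1 else 0) + 2 ^ N * (7 / √(N + 1 : ℕ)) := by
  have hs : 0 < √((N + 1 : ℕ) : ℝ) := by positivity
  set s := √((N + 1 : ℕ) : ℝ) with hsdef
  set W := stdBinom (N + 1) with hW
  have h1 := sum_choose_mul_stdBinom N fun k => steinSol z (W k)
  rw [sum_choose_succ_mul N fun k => W k * steinSol z (W k), ← hsdef] at h1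
  have hWs : ∀ j, W (j + 1) = W j + 2 / s := stdBinom_succ (N + 1)
  have h2 : ∑ j ∈ range (N + 1), (N.choose j : ℝ) * (steinSol z (W (j + 1)) - steinSol z (W j)) ≤
      ∑ j ∈ range (N + 1), (N.choose j : ℝ) *
        (((W j * steinSol z (W j) + W (j + 1) * steinSol z (W (j + 1))) / 2
          + 2 / s * (|W j| + |W (j + 1)| + 3 / 2)
          + (if W j ≤ z then 1 else 0) - normalCDF z) * (2 / s)) := by
    refine sum_le_sum fun j _ => mul_le_mul_of_nonneg_left ?_ (Nat.cast_nonneg _)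
    have := steinSol_sub_le (z := z) (a := W j) (b := W (j + 1))
      (by rw [hWs]; linarith [div_pos two_pos hs])
    rwa [show W (j + 1) - W j = 2 / s by rw [hWs]; ring] at this
  have h3 := mul_le_mul_of_nonneg_left h2 hs.le
  rw [← h1, mul_sum] at h3
  have h4 : ∑ j ∈ range (N + 1), s * ((N.choose j : ℝ) *
        (((W j * steinSol z (W j) + W (j + 1) * steinSol z (W (j + 1))) / 2
          + 2 / s * (|W j| + |W (j + 1)| + 3 / 2)
          + (if W j ≤ z then 1 else 0) - normalCDF z) * (2 / s)))
      = ∑ j ∈ range (N + 1), (N.choose j : ℝ) *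
          (W j * steinSol z (W j) + W (j + 1) * steinSol z (W (j + 1)))
        + 4 / s * ∑ j ∈ range (N + 1), (N.choose j : ℝ) * (|W j| + |W (j + 1)|)
        + 6 / s * ∑ j ∈ range (N + 1), (N.choose j : ℝ)
        + 2 * ∑ j ∈ range (N + 1), (N.choose j : ℝ) * (if W j ≤ z then 1 else 0)
        - 2 * normalCDF z * ∑ j ∈ range (N + 1), (N.choose j : ℝ) := by
    simp only [mul_sum]
    rw [← sum_add_distrib, ← sum_add_distrib, ← sum_add_distrib, ← sum_sub_distrib]
    refine sum_congr rfl fun j _ => ?_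
    field_simp; ring
  rw [h4, sum_choose_cast] at h3
  have h5 := mul_le_mul_of_nonneg_left (sum_choose_mul_abs_stdBinom_le N) (div_pos four_pos hs).le
  rw [← hW] at h5
  have h6 : 4 / s * (2 * 2 ^ N) + 6 / s * 2 ^ N = 2 * (2 ^ N * (7 / s)) := by ring
  linarith

lemma sum_choose_le_normalCDF (N : ℕ) (z : ℝ) :
    ∑ j ∈ range (N + 1), (N.choose j : ℝ) *
      (if stdBinom (N + 1) (j + 1) ≤ z then 1 else 0)
        ≤ 2 ^ N * normalCDF z + 2 ^ N * (7 / √(N + 1 : ℕ)) := by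
  have hs : 0 < √((N + 1 : ℕ) : ℝ) := by positivity
  set s := √((N + 1 : ℕ) : ℝ) with hsdef
  set W := stdBinom (N + 1) with hW
  have h1 := sum_choose_mul_stdBinom N fun k => steinSol z (W k)
  rw [sum_choose_succ_mul N fun k => W k * steinSol z (W k), ← hsdef] at h1
  have hWs : ∀ j, W (j + 1) = W j + 2 / s := stdBinom_succ (N + 1)
  have h2 : ∑ j ∈ range (N + 1), (N.choose j : ℝ) *
        (((W j * steinSol z (W j) + W (j + 1) * steinSol z (W (j + 1))) / 2
          - 2 / s * (|W j| + |W (j + 1)| + 3 / 2)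
          + (if W (j + 1) ≤ z then 1 else 0) - normalCDF z) * (2 / s)) ≤
      ∑ j ∈ range (N + 1), (N.choose j : ℝ) *
        (steinSol z (W (j + 1)) - steinSol z (W j)) := by
    refine sum_le_sum fun j _ => mul_le_mul_of_nonneg_left ?_ (Nat.cast_nonneg _)
    have := le_steinSol_sub (z := z) (a := W j) (b := W (j + 1))
      (by rw [hWs]; linarith [div_pos two_pos hs])
    rwa [show W (j + 1) - W j = 2 / s by rw [hWs]; ring] at this
  have h3 := mul_le_mul_of_nonneg_left h2 hs.le
  rw [← h1, mul_sum] at h3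
  have h4 : ∑ j ∈ range (N + 1), s * ((N.choose j : ℝ) *
        (((W j * steinSol z (W j) + W (j + 1) * steinSol z (W (j + 1))) / 2
          - 2 / s * (|W j| + |W (j + 1)| + 3 / 2)
          + (if W (j + 1) ≤ z then 1 else 0) - normalCDF z) * (2 / s)))
      = ∑ j ∈ range (N + 1), (N.choose j : ℝ) *
          (W j * steinSol z (W j) + W (j + 1) * steinSol z (W (j + 1)))
        - 4 / s * ∑ j ∈ range (N + 1), (N.choose j : ℝ) * (|W j| + |W (j + 1)|)
        - 6 / s * ∑ j ∈ range (N + 1), (N.choose j : ℝ)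
        + 2 * ∑ j ∈ range (N + 1), (N.choose j : ℝ) * (if W (j + 1) ≤ z then 1 else 0)
        - 2 * normalCDF z * ∑ j ∈ range (N + 1), (N.choose j : ℝ) := by
    simp only [mul_sum]
    rw [← sum_sub_distrib, ← sum_sub_distrib, ← sum_add_distrib, ← sum_sub_distrib]
    refine sum_congr rfl fun j _ => ?_
    field_simp; ring
  rw [h4, sum_choose_cast] at h3
  have h5 := mul_le_mul_of_nonneg_left (sum_choose_mul_abs_stdBinom_le N) (div_pos four_pos hs).le
  rw [← hW] at h5
  have h6 : 4 / s * (2 * 2 ^ N) + 6 / s * 2 ^ N = 2 * (2 ^ N * (7 / s)) := by ring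
  linarith

/-- Berry–Esseen bound for the symmetric binomial distribution. -/
theorem binomial_berry_esseen {n : ℕ} (hn : n ≠ 0) (z : ℝ) :
    |(∑ k ∈ range (n + 1), (n.choose k : ℝ) * (if stdBinom n k ≤ z then 1 else 0)) / 2 ^ n
      - normalCDF z| ≤ 8 / √n := by
  obtain ⟨N, rfl⟩ := Nat.exists_eq_succ_of_ne_zero hn
  simp only [Nat.succ_eq_add_one]
  have hs : 0 < √((N + 1 : ℕ) : ℝ) := by positivity
  rw [sum_choose_succ_mul N fun k => if stdBinom (N + 1) k ≤ z then (1 : ℝ) else 0]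
  set s := √((N + 1 : ℕ) : ℝ) with hsdef
  set W := stdBinom (N + 1) with hW
  have hWs : ∀ j, W (j + 1) = W j + 2 / s := stdBinom_succ (N + 1)
  have hs2 : 0 < 2 / s := div_pos two_pos hs
  have h2N : (0 : ℝ) < 2 ^ N := by positivity
  have hshift : ∀ j, W (j + 1) ≤ z + 2 / s ↔ W j ≤ z := fun j => by rw [hWs]; simp
  have hshift' : ∀ j, W j ≤ z - 2 / s ↔ W (j + 1) ≤ z := fun j => by rw [hWs]; exact le_sub_iff_add_le
  have hmono : ∀ j, (if W (j + 1) ≤ z then (1 : ℝ) else 0) ≤ if W j ≤ z then 1 else 0 := by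
    intro j
    have := hWs j
    split_ifs <;> linarith
  have up := sum_choose_le_normalCDF N (z + 2 / s)
  have lo := normalCDF_le_sum_choose N (z - 2 / s)
  rw [← hW, ← hsdef] at up lo
  simp only [hshift] at up
  simp only [hshift'] at lo
  have c1 := normalCDF_add_le z hs2.le
  have c2 := normalCDF_add_le (z - 2 / s) hs2.le
  rw [sub_add_cancel] at c2
  have e1 : ∑ j ∈ range (N + 1), (N.choose j : ℝ) *
      ((if W j ≤ z then 1 else 0) + if W (j + 1) ≤ z then 1 else 0) ≤
      2 * ∑ j ∈ range (N + 1), (N.choose j : ℝ) * (if W j ≤ z then 1 else 0) := by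
    rw [mul_sum]
    refine sum_le_sum fun j _ => ?_
    nlinarith [hmono j, (Nat.cast_nonneg (N.choose j) : (0 : ℝ) ≤ _)]
  have e2 : 2 * ∑ j ∈ range (N + 1), (N.choose j : ℝ) * (if W (j + 1) ≤ z then 1 else 0) ≤
      ∑ j ∈ range (N + 1), (N.choose j : ℝ) *
      ((if W j ≤ z then 1 else 0) + if W (j + 1) ≤ z then 1 else 0) := by
    rw [mul_sum]
    refine sum_le_sum fun j _ => ?_
    nlinarith [hmono j, (Nat.cast_nonneg (N.choose j) : (0 : ℝ) ≤ _)]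
  have c3 := mul_le_mul_of_nonneg_left c1 h2N.le
  have c4 := mul_le_mul_of_nonneg_left c2 h2N.le
  have e3 : (2 : ℝ) ^ N * (7 / s) + 2 ^ N * (2 / s / 2) = 2 ^ N * (8 / s) := by ring
  rw [abs_le, pow_succ]
  constructor
  · rw [le_sub_iff_add_le, le_div_iff₀ (by positivity)]
    nlinarith
  · rw [sub_le_iff_le_add, div_le_iff₀ (by positivity)]
    nlinarith

/-- The number of `true` entries of a point of the cube. -/
def hammingWeight {n : ℕ} (x : Fin n → Bool) : ℕ := (univ.filter fun j => x j = true).card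

/-- The sign character `(-1) ^ ⟨b, x⟩` of the cube. -/
def signChar {n : ℕ} (b x : Fin n → Bool) : ℝ := ∏ j, if b j && x j then -1 else 1

/-- The points of the cube whose weight lies in `S`. -/
def layer (n : ℕ) (S : Finset ℕ) : Finset (Fin n → Bool) :=
  univ.filter fun x => hammingWeight x ∈ S

/-- The (unnormalized) Fourier coefficient of the indicator function of `layer n S`. -/
def layerSum {n : ℕ} (S : Finset ℕ) (b : Fin n → Bool) : ℝ := ∑ x ∈ layer n S, signChar b x

lemma hammingWeight_le {n : ℕ} (x : Fin n → Bool) : hammingWeight x ≤ n :=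
  (card_filter_le _ _).trans_eq (card_fin n)

lemma mem_layer {n : ℕ} {S : Finset ℕ} {x : Fin n → Bool} :
    x ∈ layer n S ↔ hammingWeight x ∈ S := by simp [layer]

lemma card_layer_singleton (n s : ℕ) : (layer n {s}).card = n.choose s := by
  rw [← card_fin n, ← card_powersetCard, card_fin]
  refine card_bij' (fun x _ => univ.filter fun j => x j = true) (fun A _ j => decide (j ∈ A))
    ?_ ?_ ?_ ?_
  · intro x hx
    simpa [mem_layer, hammingWeight, mem_powersetCard] using hx
  · intro A hA
    simpa [mem_layer, hammingWeight, mem_powersetCard] using hA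
  · intro x _; ext; simp
  · intro A _; ext; simp

lemma card_layer_pair {n s t : ℕ} (h : s ≠ t) :
    (layer n {s, t}).card = n.choose s + n.choose t := by
  rw [← card_layer_singleton, ← card_layer_singleton, ← card_union_of_disjoint]
  · congr 1; ext x; simp [mem_layer]
  · rw [disjoint_left]
    intro x hx hx'
    simp only [mem_layer, mem_singleton] at hx hx'
    exact h (hx.symm.trans hx')

lemma abs_signChar {n : ℕ} (b x : Fin n → Bool) : |signChar b x| = 1 := by
  rw [signChar, abs_prod]
  exact prod_eq_one fun j _ => by split_ifs <;> simp

lemma abs_layerSum_le {n : ℕ} (S : Finset ℕ) (b : Fin n → Bool) :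
    |layerSum S b| ≤ (layer n S).card := by
  refine (abs_sum_le_sum_abs _ _).trans ?_
  simp [abs_signChar]

lemma sum_cube_prod {n : ℕ} (g : Fin n → Bool → ℝ) :
    ∑ b : Fin n → Bool, ∏ j, g j (b j) = ∏ j, (g j true + g j false) := by
  have := (Finset.prod_univ_sum (fun _ : Fin n => (univ : Finset Bool)) g).symm
  rw [Fintype.piFinset_univ] at this
  rw [this]
  exact prod_congr rfl fun j _ => by simp

lemma sum_signChar_mul {n : ℕ} (x y : Fin n → Bool) :
    ∑ b, signChar b x * signChar b y = if x = y then (2 : ℝ) ^ n else 0 := by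
  simp only [signChar, ← prod_mul_distrib]
  rw [sum_cube_prod fun j c => (if c && x j then (-1 : ℝ) else 1) * if c && y j then -1 else 1]
  split_ifs with h
  · subst h
    rw [prod_eq_pow_card (b := 2), card_fin]
    intro j _
    cases x j <;> norm_num
  · obtain ⟨j, hj⟩ := Function.ne_iff.1 h
    refine prod_eq_zero (mem_univ j) ?_
    revert hj
    cases x j <;> cases y j <;> norm_num

/-- Parseval's identity on the cube. -/
lemma sum_sq_sum_mul_signChar {n : ℕ} (F : (Fin n → Bool) → ℝ) :
    ∑ b, (∑ x, F x * signChar b x) ^ 2 = 2 ^ n * ∑ x, F x ^ 2 := by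
  calc ∑ b, (∑ x, F x * signChar b x) ^ 2
      = ∑ b, ∑ x, ∑ y, F x * F y * (signChar b x * signChar b y) := by
        refine sum_congr rfl fun b _ => ?_
        rw [sq, sum_mul_sum]
        exact sum_congr rfl fun x _ => sum_congr rfl fun y _ => by ring
    _ = ∑ x, ∑ y, F x * F y * ∑ b, signChar b x * signChar b y := by
        rw [sum_comm]
        refine sum_congr rfl fun x _ => ?_
        rw [sum_comm]
        exact sum_congr rfl fun y _ => by rw [mul_sum]
    _ = _ := by
        simp only [sum_signChar_mul, mul_ite, mul_zero, sum_ite_eq, mem_univ, if_true, mul_sum]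
        exact sum_congr rfl fun x _ => by ring

lemma sum_sq_layerSum {n : ℕ} (S : Finset ℕ) :
    ∑ b : Fin n → Bool, layerSum S b ^ 2 = 2 ^ n * (layer n S).card := by
  have := sum_sq_sum_mul_signChar fun x : Fin n → Bool => if x ∈ layer n S then (1 : ℝ) else 0
  simp only [ite_mul, one_mul, zero_mul, sum_ite_mem, univ_inter] at this
  simp only [layerSum, this]
  simp

lemma hammingWeight_comp {n : ℕ} (x : Fin n → Bool) (σ : Equiv.Perm (Fin n)) :
    hammingWeight (x ∘ σ) = hammingWeight x :=
  card_bij (fun j _ => σ j) (by simp) (by simp) fun j hj => ⟨σ.symm j, by simpa using hj, by simp⟩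

lemma layerSum_comp {n : ℕ} (S : Finset ℕ) (b : Fin n → Bool) (σ : Equiv.Perm (Fin n)) :
    layerSum S (b ∘ σ) = layerSum S b := by
  refine sum_bij' (fun x _ => x ∘ σ.symm) (fun x _ => x ∘ σ) ?_ ?_ ?_ ?_ ?_
  · intro x hx; rwa [mem_layer, hammingWeight_comp, ← mem_layer]
  · intro x hx; rwa [mem_layer, hammingWeight_comp, ← mem_layer]
  · intro x _; funext j; simp
  · intro x _; funext j; simp
  · intro x _
    exact Fintype.prod_equiv σ _ _ fun j => by simp

lemma layerSum_eq_of_hammingWeight_eq {n : ℕ} (S : Finset ℕ) {b b' : Fin n → Bool}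
    (h : hammingWeight b = hammingWeight b') : layerSum S b = layerSum S b' := by
  have e : {j // b j = true} ≃ {j // b' j = true} := by
    refine Fintype.equivOfCardEq ?_
    rw [Fintype.card_subtype, Fintype.card_subtype]; exact h
  have hσ : b = b' ∘ e.extendSubtype := by
    funext j
    by_cases hj : b j = true
    · simp [hj, e.extendSubtype_mem j hj]
    · have := e.extendSubtype_not_mem j hj
      simp only [Bool.not_eq_true] at hj this
      simp [hj, this]
  rw [hσ, layerSum_comp]

lemma choose_mul_sq_layerSum_le {n : ℕ} (S : Finset ℕ) (b : Fin n → Bool) :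
    (n.choose (hammingWeight b) : ℝ) * layerSum S b ^ 2 ≤ 2 ^ n * (layer n S).card := by
  rw [← sum_sq_layerSum, ← card_layer_singleton, ← nsmul_eq_mul, ← sum_const]
  refine (sum_congr rfl fun b' hb' => ?_).trans_le
    (sum_le_sum_of_subset_of_nonneg (subset_univ (layer n {hammingWeight b}))
      fun _ _ _ => sq_nonneg _)
  rw [mem_layer, mem_singleton] at hb'
  rw [layerSum_eq_of_hammingWeight_eq S hb']

lemma hammingWeight_not {n : ℕ} (x : Fin n → Bool) :
    hammingWeight (fun j => !x j) = n - hammingWeight x := by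
  have := card_filter_add_card_filter_not (s := (univ : Finset (Fin n))) fun j => x j = true
  simp only [card_fin] at this
  simp only [hammingWeight, Bool.not_eq_true'] at *
  simp only [Bool.not_eq_true] at this
  omega

lemma prod_ite_neg_one {n : ℕ} (x : Fin n → Bool) :
    (∏ j, if x j then (-1 : ℝ) else 1) = (-1) ^ hammingWeight x := by
  rw [prod_ite, prod_const_one, mul_one, prod_const]; rfl

lemma layerSum_middle_eq_zero {m : ℕ} {b : Fin (2 * m + 1) → Bool} (hb : Odd (hammingWeight b)) :
    layerSum {m, m + 1} b = 0 := by
  have h : layerSum {m, m + 1} b = ∑ x ∈ layer (2 * m + 1) {m, m + 1}, -signChar b x := by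
    refine sum_bij' (fun x _ j => !x j) (fun x _ j => !x j) ?_ ?_ ?_ ?_ ?_
    · intro x hx
      rw [mem_layer] at hx ⊢
      rw [hammingWeight_not]
      simp only [mem_insert, mem_singleton] at hx ⊢
      omega
    · intro x hx
      rw [mem_layer] at hx ⊢
      rw [hammingWeight_not]
      simp only [mem_insert, mem_singleton] at hx ⊢
      omega
    · intro x _; simp
    · intro x _; simp
    · intro x _
      have h1 : signChar b x = (-1) ^ hammingWeight b * signChar b fun j => !x j := by
        rw [← prod_ite_neg_one, signChar, signChar, ← prod_mul_distrib]
        refine prod_congr rfl fun j _ => ?_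
        cases b j <;> cases x j <;> norm_num
      rw [h1, hb.neg_one_pow]; ring
  rw [sum_neg_distrib] at h
  have h2 : layerSum {m, m + 1} b = -layerSum {m, m + 1} b := h
  linarith

lemma sum_ite_neg_one {n : ℕ} (x : Fin n → Bool) :
    (∑ j, if x j then (-1 : ℝ) else 1) = n - 2 * hammingWeight x := by
  have h1 : ∀ j, (if x j then (-1 : ℝ) else 1) = 1 - 2 * if x j = true then 1 else 0 := by
    intro j; cases x j <;> norm_num
  simp only [h1, sum_sub_distrib, ← mul_sum]
  simp [hammingWeight]

lemma mul_abs_layerSum_middle_le {m : ℕ} {b : Fin (2 * m + 1) → Bool}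
    (hb : hammingWeight b = 2 * m) :
    (2 * m + 1 : ℝ) * |layerSum {m, m + 1} b| ≤ (layer (2 * m + 1) {m, m + 1}).card := by
  have hw : ∀ i : Fin (2 * m + 1), hammingWeight (fun j => decide (j ≠ i)) = 2 * m := by
    intro i
    have : (univ.filter fun j : Fin (2 * m + 1) => decide (j ≠ i) = true) = univ.erase i := by
      ext; simp
    rw [hammingWeight, this, card_erase_of_mem (mem_univ i), card_fin]; omega
  have h1 : (2 * m + 1 : ℝ) * layerSum {m, m + 1} b
      = ∑ x ∈ layer (2 * m + 1) {m, m + 1},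
        ∑ i, signChar (fun j : Fin (2 * m + 1) => decide (j ≠ i)) x := by
    rw [sum_comm]
    have : ∀ i : Fin (2 * m + 1), ∑ x ∈ layer (2 * m + 1) {m, m + 1},
        signChar (fun j : Fin (2 * m + 1) => decide (j ≠ i)) x = layerSum {m, m + 1} b :=
      fun i => layerSum_eq_of_hammingWeight_eq _ ((hw i).trans hb.symm)
    simp only [this, sum_const, card_fin, nsmul_eq_mul]
    push_cast; ring
  have h2 : ∀ (x : Fin (2 * m + 1) → Bool) (i : Fin (2 * m + 1)),
      signChar (fun j => decide (j ≠ i)) x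
        = (-1) ^ hammingWeight x * if x i then (-1 : ℝ) else 1 := by
    intro x i
    rw [← prod_ite_neg_one, signChar, ← mul_prod_erase univ _ (mem_univ i),
      ← mul_prod_erase univ (fun j => if x j then (-1 : ℝ) else 1) (mem_univ i)]
    have h3 : ∀ j ∈ univ.erase i, (if decide (j ≠ i) && x j then (-1 : ℝ) else 1)
        = if x j then -1 else 1 := fun j hj => by simp [ne_of_mem_erase hj]
    rw [prod_congr rfl h3]
    cases x i <;> simp
  have h0 : (0 : ℝ) ≤ 2 * m + 1 := by positivity
  rw [← abs_of_nonneg h0, ← abs_mul, h1]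
  refine (abs_sum_le_sum_abs _ _).trans ?_
  rw [card_eq_sum_ones]
  push_cast
  refine sum_le_sum fun x hx => ?_
  simp only [h2]
  rw [← mul_sum, abs_mul, abs_pow, abs_neg, abs_one, one_pow, one_mul, sum_ite_neg_one]
  rw [mem_layer, mem_insert, mem_singleton] at hx
  rcases hx with hx | hx <;> rw [hx] <;> push_cast <;> rw [abs_le] <;> constructor <;> linarith

lemma signChar_comm {n : ℕ} (b x : Fin n → Bool) : signChar b x = signChar x b := by
  simp only [signChar, Bool.and_comm]

lemma sum_signChar_eq_zero {n : ℕ} {b : Fin n → Bool} (hb : hammingWeight b ≠ 0) :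
    ∑ x, signChar b x = 0 := by
  have h := sum_signChar_mul b fun _ => false
  rw [if_neg (by rintro rfl; simp [hammingWeight] at hb)] at h
  rw [← h]
  refine sum_congr rfl fun x _ => ?_
  rw [signChar_comm b x, signChar.eq_def x fun _ => false]
  simp

lemma signChar_of_hammingWeight_eq_zero {n : ℕ} {b : Fin n → Bool} (hb : hammingWeight b = 0)
    (x : Fin n → Bool) : signChar b x = 1 := by
  have h : ∀ j, b j = false := by simpa [hammingWeight, filter_eq_empty_iff] using hb
  simp [signChar, h]

/-- The distance between the law of `X` under the uniform distribution on `T`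
and the uniform distribution on the cube is controlled by the nontrivial Fourier coefficients. -/
lemma sq_prob_sub_le {n : ℕ} {ι : Type*} (T : Finset ι) (hT : T.Nonempty) (X : ι → Fin n → Bool)
    (D : Finset (Fin n → Bool)) :
    (((T.filter fun e => X e ∈ D).card : ℝ) / T.card - D.card / 2 ^ n) ^ 2
      ≤ ∑ b with hammingWeight b ≠ 0, ((∑ e ∈ T, signChar b (X e)) / T.card) ^ 2 := by
  have hT0 : (T.card : ℝ) ≠ 0 := by exact_mod_cast hT.card_pos.ne'
  set F : (Fin n → Bool) → ℝ := fun x =>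
    ((T.filter fun e => X e = x).card : ℝ) / T.card - 1 / 2 ^ n with hF
  have h1 : ((T.filter fun e => X e ∈ D).card : ℝ) / T.card - D.card / 2 ^ n = ∑ x ∈ D, F x := by
    simp only [hF]
    rw [sum_sub_distrib, ← sum_div, sum_const, nsmul_eq_mul, mul_one_div]
    congr 2
    rw [card_eq_sum_card_fiberwise (s := T.filter fun e => X e ∈ D) (f := X) (t := D)
      (fun e he => (mem_filter.1 he).2)]
    push_cast
    refine sum_congr rfl fun x hx => ?_
    rw [filter_filter]
    congr 2
    ext e
    simp only [mem_filter]
    constructor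
    · rintro ⟨a, -, c⟩; exact ⟨a, c⟩
    · rintro ⟨a, c⟩; exact ⟨a, c ▸ hx, c⟩
  have h2 : ∀ b, ∑ x, F x * signChar b x
      = (∑ e ∈ T, signChar b (X e)) / T.card - (∑ x, signChar b x) / 2 ^ n := by
    intro b
    simp only [hF, sub_mul, sum_sub_distrib, sum_div]
    congr 1
    · simp only [div_mul_eq_mul_div, ← sum_div]
      congr 1
      rw [← sum_fiberwise_of_maps_to (t := univ) (g := X) fun _ _ => mem_univ _]
      refine sum_congr rfl fun x _ => ?_
      rw [← nsmul_eq_mul, ← sum_const]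
      exact sum_congr rfl fun e he => by rw [(mem_filter.1 he).2]
    · exact sum_congr rfl fun x _ => by ring
  have hD : (D.card : ℝ) ≤ 2 ^ n := by
    have := card_le_univ D
    rw [Fintype.card_fun, Fintype.card_bool, Fintype.card_fin] at this
    exact_mod_cast this
  calc _ = (∑ x ∈ D, F x) ^ 2 := by rw [h1]
    _ ≤ D.card * ∑ x ∈ D, F x ^ 2 := sq_sum_le_card_mul_sum_sq
    _ ≤ 2 ^ n * ∑ x, F x ^ 2 :=
        mul_le_mul hD (sum_le_sum_of_subset_of_nonneg (subset_univ D) fun _ _ _ => sq_nonneg _)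
          (sum_nonneg fun _ _ => sq_nonneg _) (by positivity)
    _ = ∑ b, (∑ x, F x * signChar b x) ^ 2 := (sum_sq_sum_mul_signChar F).symm
    _ = ∑ b with hammingWeight b ≠ 0, (∑ x, F x * signChar b x) ^ 2 := by
        symm
        refine sum_subset (filter_subset _ _) fun b _ hb => ?_
        have hb0 : hammingWeight b = 0 := by simpa using hb
        rw [h2]
        have hs1 : ∑ e ∈ T, signChar b (X e) = T.card := by
          simp [signChar_of_hammingWeight_eq_zero hb0]
        have hs2 : ∑ x, signChar b x = 2 ^ n := by
          simp [signChar_of_hammingWeight_eq_zero hb0]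
        rw [hs1, hs2, div_self hT0, div_self (pow_ne_zero n two_ne_zero), sub_self]
        exact zero_pow two_ne_zero
    _ = _ := by
        refine sum_congr rfl fun b hb => ?_
        rw [h2, sum_signChar_eq_zero (mem_filter.1 hb).2, zero_div, sub_zero]

lemma signChar_bulbOn {n k : ℕ} (b : Fin n → Bool) (e : Fin k → Fin n → Bool) :
    signChar b (bulbOn e) = ∏ r, signChar b (e r) := by
  simp only [signChar]
  rw [prod_comm]
  refine prod_congr rfl fun j _ => ?_
  have h := prod_ite_neg_one fun r => e r j
  cases b j
  · simp
  · simp only [Bool.true_and]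
    rw [h]
    change (if bulbOn e j then (-1 : ℝ) else 1)
      = (-1) ^ (univ.filter fun r => e r j = true).card
    rcases Nat.even_or_odd (univ.filter fun r => e r j = true).card with he | ho
    · rw [he.neg_one_pow, bulbOn, Nat.even_iff.1 he]; simp
    · rw [ho.neg_one_pow, bulbOn, Nat.odd_iff.1 ho]; simp

lemma sum_signChar_bulbOn {n k : ℕ} (S : Fin k → Finset ℕ) (b : Fin n → Bool) :
    ∑ e ∈ Fintype.piFinset (fun r => layer n (S r)), signChar b (bulbOn e)
      = ∏ r, layerSum (S r) b := by
  simp only [layerSum, prod_univ_sum, signChar_bulbOn]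

/-- The admissible numbers of switches in stage `r` of the symmetrized odd process. -/
def oddSizes (m r : ℕ) : Finset ℕ := if r + 1 = m ∨ r + 1 = m + 1 then {m, m + 1} else {r + 1}

/-- The arrays of switch variables of the symmetrized odd process. -/
def oddArrays (n m : ℕ) : Finset (Fin n → Fin n → Bool) :=
  Fintype.piFinset fun r : Fin n => layer n (oddSizes m r)

/-- The normalized squared Fourier coefficient of a layer. -/
noncomputable def layerCoeffSq {n : ℕ} (S : Finset ℕ) (b : Fin n → Bool) : ℝ :=
  (layerSum S b / (layer n S).card) ^ 2

lemma layerCoeffSq_nonneg {n : ℕ} (S : Finset ℕ) (b : Fin n → Bool) : 0 ≤ layerCoeffSq S b :=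
  sq_nonneg _

lemma layerCoeffSq_le_one {n : ℕ} (S : Finset ℕ) (b : Fin n → Bool) : layerCoeffSq S b ≤ 1 := by
  rw [layerCoeffSq, sq_le_one_iff_abs_le_one, abs_div, Nat.abs_cast]
  exact div_le_one_of_le₀ (abs_layerSum_le S b) (Nat.cast_nonneg _)

lemma layerCoeffSq_le {n : ℕ} {S : Finset ℕ} {b : Fin n → Bool} {c : ℝ}
    (hc : (2 : ℝ) ^ n ≤ c * (layer n S).card) :
    layerCoeffSq S b ≤ c / n.choose (hammingWeight b) := by
  have hC : (0 : ℝ) < n.choose (hammingWeight b) := by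
    exact_mod_cast Nat.choose_pos (hammingWeight_le b)
  have hL : (0 : ℝ) < (layer n S).card := by
    rcases (Nat.cast_nonneg (layer n S).card : (0 : ℝ) ≤ _).eq_or_lt with h | h
    · rw [← h, mul_zero] at hc
      exact absurd hc (by simp)
    · exact h
  have := choose_mul_sq_layerSum_le S b
  rw [layerCoeffSq, div_pow, div_le_div_iff₀ (by positivity) hC]
  nlinarith

lemma two_pow_le_mul_choose_middle (m : ℕ) :
    (2 : ℝ) ^ (2 * m + 1) ≤ (2 * m + 2) * (2 * m + 1).choose m := by
  rw [← sum_choose_cast]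
  calc ∑ j ∈ range (2 * m + 1 + 1), ((2 * m + 1).choose j : ℝ)
      ≤ ∑ _j ∈ range (2 * m + 1 + 1), ((2 * m + 1).choose m : ℝ) := by
        refine sum_le_sum fun j _ => ?_
        have := Nat.choose_le_middle j (2 * m + 1)
        rw [show (2 * m + 1) / 2 = m by omega] at this
        exact_mod_cast this
    _ = _ := by rw [sum_const, card_range, nsmul_eq_mul]; push_cast; ring

lemma choose_middle_symm (m : ℕ) : (2 * m + 1).choose (m + 1) = (2 * m + 1).choose m :=
  Nat.choose_symm_of_eq_add (by ring)

lemma card_layer_middle (m : ℕ) :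
    (layer (2 * m + 1) {m, m + 1}).card = 2 * (2 * m + 1).choose m := by
  rw [card_layer_pair (by omega), choose_middle_symm]; ring

lemma choose_middle_le {m : ℕ} (hm : 2 ≤ m) :
    (2 * m + 1).choose m ≤ 2 * (2 * m + 1).choose (m - 1) := by
  obtain ⟨l, rfl⟩ : ∃ l, m = l + 1 := ⟨m - 1, by omega⟩
  have := Nat.choose_succ_right_eq (2 * (l + 1) + 1) l
  rw [show 2 * (l + 1) + 1 - l = l + 3 by omega] at this
  simp only [Nat.add_sub_cancel]
  by_contra! h
  nlinarith

lemma choose_two_le_choose {n k : ℕ} (hk : 2 ≤ k) (hkn : k + 2 ≤ n) :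
    n.choose 2 ≤ n.choose k := by
  have key : ∀ k, 2 ≤ k → k ≤ n / 2 → n.choose 2 ≤ n.choose k := by
    intro k hk
    induction k, hk using Nat.le_induction with
    | base => exact fun _ => le_rfl
    | succ k _ ih =>
      intro h
      exact (ih (by omega)).trans (Nat.choose_le_succ_of_lt_half_left (by omega))
  rcases le_or_gt k (n / 2) with h | h
  · exact key k hk h
  · rw [← Nat.choose_symm (by omega : k ≤ n)]
    exact key (n - k) (by omega) (by omega)

lemma prod_oddSizes_le {m : ℕ} (hm : 3 ≤ m) (b : Fin (2 * m + 1) → Bool) :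
    ∏ r : Fin (2 * m + 1), layerCoeffSq (oddSizes m r) b
      ≤ layerCoeffSq {m, m + 1} b ^ 2 *
        (layerCoeffSq {m - 1} b * layerCoeffSq {m + 2} b) := by
  set f : ℕ → ℝ := fun r => layerCoeffSq (oddSizes m r) b with hf
  have h0 : ∀ r, 0 ≤ f r := fun r => layerCoeffSq_nonneg _ _
  have h1 : ∀ r, f r ≤ 1 := fun r => layerCoeffSq_le_one _ _
  rw [Fin.prod_univ_eq_prod_range f (2 * m + 1)]
  have hsub : ({m - 1, m, m - 2, m + 1} : Finset ℕ) ⊆ range (2 * m + 1) := by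
    intro r hr
    simp only [mem_insert, mem_singleton] at hr
    rw [mem_range]; omega
  rw [← prod_sdiff hsub]
  have h2 : ∏ r ∈ range (2 * m + 1) \ {m - 1, m, m - 2, m + 1}, f r ≤ 1 :=
    prod_le_one (fun r _ => h0 r) fun r _ => h1 r
  refine (mul_le_of_le_one_left (prod_nonneg fun r _ => h0 r) h2).trans_eq ?_
  rw [prod_insert (by simp; omega), prod_insert (by simp; omega), prod_insert (by simp; omega),
    prod_singleton]
  have e1 : oddSizes m (m - 1) = {m, m + 1} := by unfold oddSizes; rw [if_pos]; omega
  have e2 : oddSizes m m = {m, m + 1} := by unfold oddSizes; rw [if_pos]; omega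
  have e3 : oddSizes m (m - 2) = {m - 1} := by
    unfold oddSizes; rw [if_neg (by omega)]; congr 1; omega
  have e4 : oddSizes m (m + 1) = {m + 2} := by unfold oddSizes; rw [if_neg (by omega)]
  simp only [hf, e1, e2, e3, e4]
  ring

lemma choose_mul_prod_oddSizes_le {m : ℕ} (hm : 3 ≤ m) {b : Fin (2 * m + 1) → Bool}
    (hb : hammingWeight b ≠ 0) :
    ∏ r : Fin (2 * m + 1), layerCoeffSq (oddSizes m r) b ≤
      ((2 * m + 2 : ℝ) ^ 4 / ((2 * m + 1).choose 2 : ℝ) ^ 3) /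
        (2 * m + 1).choose (hammingWeight b) := by
  refine (prod_oddSizes_le hm b).trans ?_
  have hwle := hammingWeight_le b
  have hC : (0 : ℝ) < (2 * m + 1).choose (hammingWeight b) := by
    exact_mod_cast Nat.choose_pos hwle
  have hC2 : (0 : ℝ) < (2 * m + 1).choose 2 := by
    exact_mod_cast Nat.choose_pos (by omega)
  have hmid0 := layerCoeffSq_nonneg {m, m + 1} b
  have hlo0 := layerCoeffSq_nonneg {m - 1} b
  have hhi0 := layerCoeffSq_nonneg {m + 2} b
  have hm3 : (3 : ℝ) ≤ m := by exact_mod_cast hm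
  rcases Nat.even_or_odd (hammingWeight b) with he | ho
  · by_cases hw : hammingWeight b = 2 * m
    · have hlo1 := layerCoeffSq_le_one {m - 1} b
      have hhi1 := layerCoeffSq_le_one {m + 2} b
      have h1 : layerCoeffSq {m, m + 1} b ≤ (1 / (2 * m + 1)) ^ 2 := by
        have h := mul_abs_layerSum_middle_le hw
        have hL : (0 : ℝ) < (layer (2 * m + 1) {m, m + 1}).card := by
          rw [card_layer_middle]
          have := Nat.choose_pos (show m ≤ 2 * m + 1 by omega)
          exact_mod_cast (by omega : 0 < 2 * (2 * m + 1).choose m)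
        rw [layerCoeffSq, ← sq_abs (_ / _), abs_div, Nat.abs_cast]
        refine pow_le_pow_left₀ (by positivity) ?_ 2
        rw [div_le_div_iff₀ hL (by positivity)]
        linarith
      have h2 : layerCoeffSq {m, m + 1} b ^ 2 * (layerCoeffSq {m - 1} b * layerCoeffSq {m + 2} b)
          ≤ ((1 / (2 * m + 1 : ℝ)) ^ 2) ^ 2 * (1 * 1) := by gcongr
      refine h2.trans ?_
      have h3 : (2 * m + 1).choose (hammingWeight b) = 2 * m + 1 := by
        rw [hw, Nat.choose_succ_self_right]
      have h4 : ((2 * m + 1).choose 2 : ℝ) = (2 * m + 1) * m := by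
        rw [Nat.cast_choose_two]; push_cast; ring
      rw [h3, h4]
      push_cast
      rw [div_div, le_div_iff₀ (by positivity)]
      have h5 : ((1 / (2 * m + 1 : ℝ)) ^ 2) ^ 2 * (1 * 1) *
          (((2 * m + 1) * m) ^ 3 * (2 * m + 1)) = (m : ℝ) ^ 3 := by
        field_simp
      rw [h5]
      have h6 : (m : ℝ) ^ 3 ≤ m ^ 4 := pow_le_pow_right₀ (by linarith) (by norm_num)
      have h7 : (m : ℝ) ^ 4 ≤ (2 * m + 2) ^ 4 := pow_le_pow_left₀ (by linarith) (by linarith) 4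
      exact h6.trans h7
    · have hk2 : 2 ≤ hammingWeight b := by
        obtain ⟨c, hc⟩ := he; omega
      have hkn : hammingWeight b + 2 ≤ 2 * m + 1 := by
        obtain ⟨c, hc⟩ := he; omega
      have hCC : ((2 * m + 1).choose 2 : ℝ) ≤ (2 * m + 1).choose (hammingWeight b) := by
        exact_mod_cast choose_two_le_choose hk2 hkn
      have hmidpow := two_pow_le_mul_choose_middle m
      have hhalf : ((2 * m + 1).choose m : ℝ) ≤ 2 * (2 * m + 1).choose (m - 1) := by
        exact_mod_cast choose_middle_le (by omega : 2 ≤ m)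
      have hlow : (2 : ℝ) ^ (2 * m + 1) ≤ 2 * (2 * m + 2) * (2 * m + 1).choose (m - 1) := by
        nlinarith
      have h1 : layerCoeffSq {m, m + 1} b ≤
          ((2 * m + 2) / 2) / (2 * m + 1).choose (hammingWeight b) := by
        refine layerCoeffSq_le ?_
        rw [card_layer_middle]; push_cast; linarith
      have h2 : layerCoeffSq {m - 1} b ≤
          (2 * (2 * m + 2)) / (2 * m + 1).choose (hammingWeight b) := by
        refine layerCoeffSq_le ?_
        rw [card_layer_singleton]; exact hlow
      have h3 : layerCoeffSq {m + 2} b ≤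
          (2 * (2 * m + 2)) / (2 * m + 1).choose (hammingWeight b) := by
        refine layerCoeffSq_le ?_
        rw [card_layer_singleton,
          Nat.choose_symm_of_eq_add (by omega : 2 * m + 1 = (m + 2) + (m - 1))]
        exact hlow
      set C : ℝ := ((2 * m + 1).choose (hammingWeight b) : ℝ) with hCdef
      calc _ ≤ (((2 * m + 2 : ℝ) / 2) / C) ^ 2 * ((2 * (2 * m + 2)) / C * ((2 * (2 * m + 2)) / C))
              := by gcongr
        _ = ((2 * m + 2 : ℝ) ^ 4 / C ^ 3) / C := by field_simp
        _ ≤ _ := by gcongr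
  · rw [layerCoeffSq, layerSum_middle_eq_zero ho]
    simp only [zero_div, ne_eq, OfNat.ofNat_ne_zero, not_false_eq_true, zero_pow, zero_mul]
    positivity

lemma sum_inv_choose_hammingWeight (n : ℕ) (A : ℝ) :
    ∑ b : Fin n → Bool with hammingWeight b ≠ 0, A / n.choose (hammingWeight b) = n * A := by
  rw [← sum_fiberwise_of_maps_to (t := Icc 1 n) (g := hammingWeight)]
  · have : ∀ k ∈ Icc 1 n, ∑ b ∈ (univ.filter fun b : Fin n → Bool => hammingWeight b ≠ 0).filter
        (fun b => hammingWeight b = k), A / n.choose (hammingWeight b) = A := by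
      intro k hk
      rw [mem_Icc] at hk
      have hC : (n.choose k : ℝ) ≠ 0 := by exact_mod_cast (Nat.choose_pos hk.2).ne'
      have hset : (univ.filter fun b : Fin n → Bool => hammingWeight b ≠ 0).filter
          (fun b => hammingWeight b = k) = layer n {k} := by
        ext b
        simp only [mem_filter, mem_univ, true_and, mem_layer, mem_singleton]
        omega
      rw [hset, sum_congr rfl (g := fun _ => A / n.choose k), sum_const, card_layer_singleton,
        nsmul_eq_mul]
      · field_simp
      · intro b hb
        rw [mem_layer, mem_singleton] at hb
        rw [hb]
    rw [sum_congr rfl this, sum_const, Nat.card_Icc, nsmul_eq_mul]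
    simp
  · intro b hb
    have := (mem_filter.1 hb).2
    rw [mem_Icc]
    exact ⟨by omega, hammingWeight_le b⟩

lemma oddArrays_nonempty {n m : ℕ} (hm : n = 2 * m + 1) : (oddArrays n m).Nonempty := by
  rw [oddArrays, Fintype.piFinset_nonempty]
  intro r
  have hr := r.2
  rw [← card_pos, oddSizes]
  split_ifs
  · subst hm
    rw [card_layer_middle]
    have := Nat.choose_pos (show m ≤ 2 * m + 1 by omega)
    omega
  · rw [card_layer_singleton]
    exact Nat.choose_pos hr

/-- The law of the number of lit bulbs is close to the symmetric binomial law. -/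
lemma abs_prob_numOn_sub_binomial_le {n m : ℕ} (hm : n = 2 * m + 1) (hn : 100 ≤ n)
    (S : Set ℕ) [DecidablePred (· ∈ S)] :
    |(((oddArrays n m).filter fun e => numOn e ∈ S).card : ℝ) / (oddArrays n m).card
      - (∑ k ∈ range (n + 1), (n.choose k : ℝ) * (if k ∈ S then 1 else 0)) / 2 ^ n| ≤ 3 / √n := by
  have hcard : ∑ k ∈ range (n + 1), (n.choose k : ℝ) * (if k ∈ S then 1 else 0)
      = (univ.filter fun x : Fin n → Bool => hammingWeight x ∈ S).card := by
    rw [card_eq_sum_card_fiberwise (f := hammingWeight) (t := range (n + 1))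
      (fun x _ => by simpa [Nat.lt_succ_iff] using hammingWeight_le x)]
    push_cast
    refine sum_congr rfl fun k _ => ?_
    rw [← card_layer_singleton, filter_filter]
    split_ifs with h
    · rw [mul_one]
      congr 2
      ext x
      simp only [mem_layer, mem_singleton, mem_filter, mem_univ, true_and]
      exact ⟨fun hx => ⟨hx ▸ h, hx⟩, fun hx => hx.2⟩
    · rw [mul_zero, eq_comm, Nat.cast_eq_zero, card_eq_zero, filter_eq_empty_iff]
      rintro x - ⟨h1, h2⟩
      exact h (h2 ▸ h1)
  have h1 := sq_prob_sub_le (oddArrays n m) (oddArrays_nonempty hm) bulbOn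
    (univ.filter fun x : Fin n → Bool => hammingWeight x ∈ S)
  have hnum : ((oddArrays n m).filter fun e =>
      bulbOn e ∈ univ.filter fun x : Fin n → Bool => hammingWeight x ∈ S)
      = (oddArrays n m).filter fun e => numOn e ∈ S := by
    ext e
    simp only [mem_filter, mem_univ, true_and]
    rfl
  rw [hnum] at h1
  rw [hcard]
  refine abs_le_of_sq_le_sq (h1.trans ?_) (by positivity)
  have h2 : ∀ b : Fin n → Bool,
      ((∑ e ∈ oddArrays n m, signChar b (bulbOn e)) / (oddArrays n m).card) ^ 2
        = ∏ r : Fin n, layerCoeffSq (oddSizes m r) b := by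
    intro b
    rw [oddArrays, sum_signChar_bulbOn, Fintype.card_piFinset, Nat.cast_prod, ← prod_div_distrib,
      ← prod_pow]
    rfl
  simp only [h2]
  subst hm
  refine (sum_le_sum fun b hb =>
    choose_mul_prod_oddSizes_le (by omega) (mem_filter.1 hb).2).trans ?_
  rw [sum_inv_choose_hammingWeight, div_pow, Real.sq_sqrt (Nat.cast_nonneg _)]
  have h4 : ((2 * m + 1).choose 2 : ℝ) = (2 * m + 1) * m := by
    rw [Nat.cast_choose_two]; push_cast; ring
  have hm50 : (50 : ℝ) ≤ m := by exact_mod_cast (by omega : 50 ≤ m)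
  have hm0 : (0 : ℝ) < m := by linarith
  rw [h4]
  push_cast
  rw [mul_div_assoc', div_le_div_iff₀ (by positivity) (by positivity)]
  obtain ⟨t, ht⟩ : ∃ t, (m : ℝ) = 50 + t := ⟨m - 50, by ring⟩
  have ht0 : 0 ≤ t := by linarith
  rw [ht, ← sub_nonneg]
  ring_nf
  positivity

lemma oddPattern_lt_two_mem_oddSizes {n m a b : ℕ} (ha : a < 2) (hb : b < 2) (r : Fin n) :
    oddPattern n m a b r ∈ oddSizes m r := by
  unfold oddPattern oddSizes
  split_ifs <;> simp only [mem_insert, mem_singleton] <;> omega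

lemma mem_validArrays_oddPattern {n m a b : ℕ} (ha : a < 2) (hb : b < 2) (hm1 : m - 1 < n)
    (hmn : m < n) (hm0 : 0 < m) (e : Fin n → Fin n → Bool) :
    e ∈ validArrays n n (oddPattern n m a b) ↔ e ∈ oddArrays n m ∧
      hammingWeight (e ⟨m - 1, hm1⟩) = m + a ∧ hammingWeight (e ⟨m, hmn⟩) = m + b := by
  have h1 : e ∈ validArrays n n (oddPattern n m a b) ↔
      ∀ r, hammingWeight (e r) = oddPattern n m a b r := by
    simp [validArrays, hammingWeight]
  have h2 : e ∈ oddArrays n m ↔ ∀ r : Fin n, hammingWeight (e r) ∈ oddSizes m r := by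
    simp [oddArrays, mem_layer]
  rw [h1, h2]
  constructor
  · intro h
    refine ⟨fun r => h r ▸ oddPattern_lt_two_mem_oddSizes ha hb r, ?_, ?_⟩
    · rw [h]; unfold oddPattern; rw [if_pos]; simp only; omega
    · rw [h]; unfold oddPattern; simp
  · rintro ⟨h, h3, h4⟩ r
    unfold oddPattern
    split_ifs with c1 c2
    · have : r = ⟨m - 1, hm1⟩ := Fin.ext (by simp only; omega)
      rw [this, h3]
    · have : r = ⟨m, hmn⟩ := Fin.ext (by simp only; omega)
      rw [this, h4]
    · have := h r
      rw [oddSizes, if_neg (by tauto), mem_singleton] at this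
      exact this

lemma card_filter_oddArrays {n m : ℕ} (hm : n = 2 * m + 1) (hm0 : 0 < m)
    (p : (Fin n → Fin n → Bool) → Prop) [DecidablePred p] :
    ((oddArrays n m).filter p).card = ∑ a ∈ range 2, ∑ b ∈ range 2,
      ((validArrays n n (oddPattern n m a b)).filter p).card := by
  have hm1 : m - 1 < n := by omega
  have hmn : m < n := by omega
  have hmid : ∀ e ∈ oddArrays n m, ∀ (r : ℕ) (hr : r < n), r + 1 = m ∨ r + 1 = m + 1 →
      hammingWeight (e ⟨r, hr⟩) = m ∨ hammingWeight (e ⟨r, hr⟩) = m + 1 := by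
    intro e he r hr h
    have := Fintype.mem_piFinset.1 he ⟨r, hr⟩
    rw [mem_layer, oddSizes, if_pos h, mem_insert, mem_singleton] at this
    exact this
  rw [← sum_product', card_eq_sum_card_fiberwise (s := (oddArrays n m).filter p)
    (f := fun e => (hammingWeight (e ⟨m - 1, hm1⟩) - m, hammingWeight (e ⟨m, hmn⟩) - m))
    (t := range 2 ×ˢ range 2)]
  · refine sum_congr rfl fun ab hab => ?_
    rw [mem_product, mem_range, mem_range] at hab
    congr 1
    ext e
    simp only [mem_filter, mem_validArrays_oddPattern hab.1 hab.2 hm1 hmn hm0, Prod.ext_iff]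
    constructor
    · rintro ⟨⟨h1, h2⟩, h3, h4⟩
      have h5 := hmid e h1 (m - 1) hm1 (by omega)
      have h6 := hmid e h1 m hmn (by omega)
      exact ⟨⟨h1, by omega, by omega⟩, h2⟩
    · rintro ⟨⟨h1, h2, h3⟩, h4⟩
      exact ⟨⟨h1, h4⟩, by omega, by omega⟩
  · intro e he
    have he' := (mem_filter.1 he).1
    have h5 := hmid e he' (m - 1) hm1 (by omega)
    have h6 := hmid e he' m hmn (by omega)
    simp only [coe_product, coe_range, Set.mem_prod, Set.mem_Iio]
    omega

lemma card_validArrays {n k : ℕ} (s : Fin k → ℕ) :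
    (validArrays n k s).card = ∏ r, n.choose (s r) := by
  have : validArrays n k s = Fintype.piFinset fun r => layer n {s r} := by
    ext e; simp [validArrays, mem_layer, hammingWeight]
  rw [this, Fintype.card_piFinset]
  simp only [card_layer_singleton]

lemma card_validArrays_oddPattern {n m a b : ℕ} (hm : n = 2 * m + 1) (ha : a < 2) (hb : b < 2) :
    (validArrays n n (oddPattern n m a b)).card
      = (validArrays n n (oddPattern n m 0 0)).card := by
  have hmid : ∀ c < 2, n.choose (m + c) = n.choose m := by
    intro c hc
    interval_cases c
    · rfl
    · subst hm; exact choose_middle_symm m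
  rw [card_validArrays, card_validArrays]
  refine prod_congr rfl fun r _ => ?_
  unfold oddPattern
  split_ifs
  · rw [hmid a ha, hmid 0 two_pos]
  · rw [hmid b hb, hmid 0 two_pos]
  · rfl

lemma mixture_eq_card_div {n m : ℕ} (hm : n = 2 * m + 1) (hm0 : 0 < m)
    (p : (Fin n → Fin n → Bool) → Prop) [DecidablePred p] :
    (1 / 4 : ENNReal) * ∑ a ∈ range 2, ∑ b ∈ range 2,
      (((validArrays n n (oddPattern n m a b)).filter p).card : ENNReal)
        / ((validArrays n n (oddPattern n m a b)).card : ENNReal)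
      = ENNReal.ofReal (((oddArrays n m).filter p).card / (oddArrays n m).card) := by
  set N := (validArrays n n (oddPattern n m 0 0)).card with hN
  have hcard : (oddArrays n m).card = 4 * N := by
    have := card_filter_oddArrays hm hm0 fun _ => True
    simp only [filter_true] at this
    rw [this, sum_congr rfl fun a ha => sum_congr rfl fun b hb =>
      card_validArrays_oddPattern hm (mem_range.1 ha) (mem_range.1 hb)]
    simp [← hN]; ring
  have hpos : 0 < N := by
    have := (oddArrays_nonempty hm).card_pos
    omega
  have h1 : ∑ a ∈ range 2, ∑ b ∈ range 2,
      (((validArrays n n (oddPattern n m a b)).filter p).card : ENNReal)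
        / ((validArrays n n (oddPattern n m a b)).card : ENNReal)
      = (((oddArrays n m).filter p).card : ENNReal) / N := by
    rw [card_filter_oddArrays hm hm0]
    push_cast
    simp only [div_eq_mul_inv, sum_mul]
    exact sum_congr rfl fun a ha => sum_congr rfl fun b hb => by
      rw [card_validArrays_oddPattern hm (mem_range.1 ha) (mem_range.1 hb)]
  have hc : (0 : ℝ) < (oddArrays n m).card := by exact_mod_cast (oddArrays_nonempty hm).card_pos
  rw [h1, ENNReal.ofReal_div_of_pos hc, ENNReal.ofReal_natCast, ENNReal.ofReal_natCast, hcard]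
  push_cast
  rw [div_eq_mul_inv, div_eq_mul_inv, div_eq_mul_inv, one_mul,
    ENNReal.mul_inv (Or.inl (by norm_num)) (Or.inl (by norm_num))]
  ring

lemma prob_preimage_eq_card_div {n m : ℕ} {Ω : Type} [MeasurableSpace Ω] (P : Measure Ω)
    (V : Ω → ℕ) (hV : Measurable V)
    (hdist : ∀ v : ℕ, P {ω | V ω = v} = ENNReal.ofReal
      (((oddArrays n m).filter fun e => numOn e = v).card / (oddArrays n m).card))
    (S : Set ℕ) [DecidablePred (· ∈ S)] :
    (P {ω | V ω ∈ S}).toReal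
      = ((oddArrays n m).filter fun e => numOn e ∈ S).card / (oddArrays n m).card := by
  have hle : ∀ e : Fin n → Fin n → Bool, numOn e ≤ n := fun e =>
    (card_filter_le _ _).trans_eq (card_fin n)
  have hmap : ∀ A : Set ℕ, (P.map V) A = P {ω | V ω ∈ A} := fun A =>
    Measure.map_apply hV (MeasurableSet.of_discrete)
  have hsing : ∀ v, (P.map V) {v} = ENNReal.ofReal
      (((oddArrays n m).filter fun e => numOn e = v).card / (oddArrays n m).card) := fun v => by
    rw [hmap, ← hdist]; rfl
  rw [← hmap, ← Measure.tsum_indicator_apply_singleton _ S MeasurableSet.of_discrete,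
    tsum_eq_sum (s := range (n + 1))]
  · have h1 : ∀ v, S.indicator (fun x => (P.map V) {x}) v = ENNReal.ofReal
        (((oddArrays n m).filter fun e => numOn e ∈ S ∧ numOn e = v).card
          / (oddArrays n m).card) := by
      intro v
      by_cases hv : v ∈ S
      · rw [Set.indicator_of_mem hv, hsing]
        have hf : ((oddArrays n m).filter fun e => numOn e ∈ S ∧ numOn e = v)
            = (oddArrays n m).filter fun e => numOn e = v :=
          filter_congr fun e _ => ⟨fun h => h.2, fun h => ⟨h ▸ hv, h⟩⟩
        rw [hf]
      · rw [Set.indicator_of_notMem hv, filter_false_of_mem]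
        · simp
        · rintro e - ⟨h1, h2⟩
          exact hv (h2 ▸ h1)
    simp only [h1]
    rw [← ENNReal.ofReal_sum_of_nonneg fun _ _ => by positivity,
      ENNReal.toReal_ofReal (sum_nonneg fun _ _ => by positivity), ← sum_div,
      card_eq_sum_card_fiberwise (s := (oddArrays n m).filter fun e => numOn e ∈ S)
        (f := numOn) (t := range (n + 1))
        (fun e _ => by simpa [Nat.lt_succ_iff] using hle e)]
    push_cast
    simp only [filter_filter]
  · intro v hv
    rw [mem_range, not_lt] at hv
    rw [Set.indicator_apply_eq_zero]
    intro _
    rw [hsing, filter_false_of_mem]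
    · simp
    · intro e _ h
      have := hle e
      omega

lemma lam_two (n s : ℕ) (hn : 2 ≤ n) :
    lam n 2 s = (((n : ℝ) - 2 * s) ^ 2 - n) / (n * (n - 1)) := by
  have hn' : (2 : ℝ) ≤ n := by exact_mod_cast hn
  have h1 : (n : ℝ) ≠ 0 := by linarith
  have h2 : (n : ℝ) - 1 ≠ 0 := by linarith
  have h3 : ∀ k : ℕ, ((k.descFactorial 2 : ℕ) : ℝ) = k * (k - 1) := Nat.cast_descFactorial_two ℝ
  simp only [lam, sum_range_succ, range_zero, sum_empty, h3, Nat.descFactorial_zero,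
    Nat.descFactorial_one]
  norm_num
  field_simp
  ring

lemma abs_lamBarFull_two_le {n m : ℕ} (hm : n = 2 * m + 1) (hn : 2 ≤ n) :
    |lamBarFull n 2 m| ≤ 1 / (n : ℝ) ^ 2 := by
  have hn' : (2 : ℝ) ≤ n := by exact_mod_cast hn
  have hnm : (n : ℝ) = 2 * m + 1 := by exact_mod_cast hm
  have h1 : (n : ℝ) ≠ 0 := by linarith
  have h2 : (n : ℝ) - 1 ≠ 0 := by linarith
  have havg : (lam n 2 m + lam n 2 (m + 1)) / 2 = -1 / n := by
    rw [lam_two n m hn, lam_two n (m + 1) hn]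
    push_cast
    rw [show (n : ℝ) - 2 * m = 1 by rw [hnm]; ring,
      show (n : ℝ) - 2 * (m + 1) = -1 by rw [hnm]; ring]
    field_simp
    ring
  have hprod : |∏ r ∈ Icc 1 n \ {m, m + 1}, lam n 2 r| ≤ 1 := by
    rw [abs_prod]
    refine prod_le_one (fun _ _ => abs_nonneg _) fun r hr => ?_
    have hr1 := (mem_Icc.1 (mem_sdiff.1 hr).1).2
    have hr2 : (r : ℝ) ≤ n := by exact_mod_cast hr1
    have hr0 : (0 : ℝ) ≤ r := Nat.cast_nonneg r
    have hd : 0 < (n : ℝ) * (n - 1) := by nlinarith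
    rw [lam_two n r hn, abs_div, abs_of_pos hd, div_le_one hd, abs_le]
    constructor
    · nlinarith [sq_nonneg ((n : ℝ) - 2 * r)]
    · nlinarith
  rw [lamBarFull, havg, abs_mul]
  calc _ ≤ 1 * |(-1 / (n : ℝ)) ^ 2| := by gcongr
    _ = 1 / (n : ℝ) ^ 2 := by rw [abs_of_nonneg (sq_nonneg _)]; ring

lemma abs_mul_normalPDF_le_one (u : ℝ) : |u * normalPDF u| ≤ 1 := by
  have h1 : (2 : ℝ) ≤ √(2 * Real.pi) := by
    apply Real.le_sqrt_of_sq_le; nlinarith [Real.pi_gt_three]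
  have h2 : (√(2 * Real.pi))⁻¹ ≤ 1 := inv_le_one_of_one_le₀ (by linarith)
  have h3 : |u| ≤ Real.exp (u ^ 2 / 2) := by
    have := Real.add_one_le_exp (u ^ 2 / 2)
    nlinarith [sq_nonneg (|u| - 1), sq_abs u]
  have h4 : |u| * Real.exp (-u ^ 2 / 2) ≤ 1 := by
    rw [neg_div, Real.exp_neg, ← div_eq_mul_inv]
    exact div_le_one_of_le₀ h3 (Real.exp_pos _).le
  rw [abs_mul, abs_of_pos (normalPDF_pos u), normalPDF]
  calc |u| * ((√(2 * Real.pi))⁻¹ * Real.exp (-u ^ 2 / 2))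
      = (√(2 * Real.pi))⁻¹ * (|u| * Real.exp (-u ^ 2 / 2)) := by ring
    _ ≤ 1 * 1 := by gcongr
    _ = 1 := one_mul 1

/-- Changing the scale of a standard normal variable changes its distribution function little. -/
lemma abs_normalCDF_mul_sub_le {a : ℝ} (ha : 1 / 2 ≤ a) (z : ℝ) :
    |normalCDF (z * a) - normalCDF z| ≤ 2 * |a - 1| := by
  have hd : ∀ t, HasDerivAt (fun t => normalCDF (z * t)) (normalPDF (z * t) * z) t := fun t => by
    have h := (hasDerivAt_id t).const_mul z
    rw [mul_one] at h
    exact (hasDerivAt_normalCDF (z * t)).comp t h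
  have := (convex_Ici (1 / 2 : ℝ)).norm_image_sub_le_of_norm_hasDerivWithin_le (C := 2)
    (f := fun t => normalCDF (z * t)) (f' := fun t => normalPDF (z * t) * z)
    (fun t _ => (hd t).hasDerivWithinAt) ?_ (show (1 : ℝ) ∈ Set.Ici (1 / 2) by norm_num)
    (show a ∈ Set.Ici (1 / 2 : ℝ) from ha)
  · simpa using this
  · intro t ht
    have ht' : (1 / 2 : ℝ) ≤ t := ht
    have h1 := abs_mul_normalPDF_le_one (z * t)
    rw [Real.norm_eq_abs]
    rw [show z * t * normalPDF (z * t) = t * (normalPDF (z * t) * z) by ring, abs_mul,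
      abs_of_pos (by linarith : 0 < t)] at h1
    nlinarith [abs_nonneg (normalPDF (z * t) * z)]

/-- Berry–Esseen bound for the symmetrized odd lightbulb variable `V`. -/
theorem lightbulb_berry_esseen_V {n m : ℕ} (hm : n = 2 * m + 1) (hn7 : 7 ≤ n)
    {Ω : Type} [MeasurableSpace Ω] (P : Measure Ω) [IsProbabilityMeasure P]
    (V : Ω → ℕ) (hV : Measurable V)
    (hdist : ∀ v : ℕ, P {ω | V ω = v}
      = (1 / 4 : ENNReal) * ∑ a ∈ Finset.range 2, ∑ b ∈ Finset.range 2,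
          (((validArrays n n (oddPattern n m a b)).filter
              (fun e => numOn e = v)).card : ENNReal)
            / ((validArrays n n (oddPattern n m a b)).card : ENNReal))
    (σV : ℝ) (hσ0 : 0 ≤ σV)
    (hσ2 : σV ^ 2 = ((n : ℝ) / 4) * (1 - lamBarFull n 2 m)
        + ((n : ℝ) ^ 2 / 4) * lamBarFull n 2 m) :
    ∀ z : ℝ,
      |(P {ω | ((V ω : ℝ) - n / 2) / σV ≤ z}).toReal
          - ((gaussianReal 0 1) (Set.Iic z)).toReal|
        ≤ (n : ℝ) / (2 * σV ^ 2) *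
              (1 / Real.sqrt n + (1 / (2 * Real.sqrt 2)) * Real.exp (-(n : ℝ) / 4))
          + 1.64 * (n : ℝ) / σV ^ 3 + 2 / σV := by
  intro z
  classical
  have hn7' : (7 : ℝ) ≤ n := by exact_mod_cast hn7
  have hn0 : (0 : ℝ) < n := by linarith
  set s := √(n : ℝ) with hs
  have hs0 : 0 < s := Real.sqrt_pos.2 hn0
  have hss : s ^ 2 = n := Real.sq_sqrt hn0.le
  set a := 2 * σV / s with ha
  have hσa : σV = a * s / 2 := by rw [ha]; field_simp
  have ha0 : 0 ≤ a := by positivity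
  have hlam := abs_le.1 (abs_lamBarFull_two_le hm (by omega))
  have ha2 : a ^ 2 = 1 + (n - 1) * lamBarFull n 2 m := by
    rw [ha, div_pow, hss, mul_pow, hσ2]; field_simp; ring
  have ha2' : |a ^ 2 - 1| ≤ 1 / (n : ℝ) := by
    have h1 : (1 : ℝ) / n ^ 2 * (n - 1) ≤ 1 / (n : ℝ) := by
      rw [div_mul_eq_mul_div, div_le_div_iff₀ (by positivity) hn0]; nlinarith
    rw [ha2, abs_le]
    constructor <;> nlinarith [hlam.1, hlam.2]
  have hn7inv : (1 : ℝ) / n ≤ 1 / 7 := one_div_le_one_div_of_le (by norm_num) hn7'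
  have ha2b := abs_le.1 (ha2'.trans hn7inv)
  have ha_lo : 1 / 2 ≤ a := by nlinarith
  have ha_hi : a ≤ 107 / 100 := by nlinarith
  have ha1 : |a - 1| ≤ 1 / (n : ℝ) := by
    refine le_trans ?_ ha2'
    rw [show a ^ 2 - 1 = (a - 1) * (a + 1) by ring, abs_mul, abs_of_pos (by linarith : 0 < a + 1)]
    nlinarith [abs_nonneg (a - 1)]
  have hapos : 0 < a := by linarith
  have hσpos : 0 < σV := by rw [hσa]; positivity
  have hRHS : 13 / s ≤ (n : ℝ) / (2 * σV ^ 2) *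
              (1 / s + (1 / (2 * √2)) * Real.exp (-(n : ℝ) / 4))
          + 1.64 * (n : ℝ) / σV ^ 3 + 2 / σV := by
    have h1 : 0 ≤ (n : ℝ) / (2 * σV ^ 2) *
      (1 / s + (1 / (2 * √2)) * Real.exp (-(n : ℝ) / 4)) := by positivity
    have h2 : 1.64 * (n : ℝ) / σV ^ 3 + 2 / σV = (13.12 / a ^ 3 + 4 / a) / s := by
      rw [hσa, ← hss]; field_simp; ring
    have h3 : (13 : ℝ) ≤ 13.12 / a ^ 3 + 4 / a := by
      have : (13.12 : ℝ) / (107 / 100) ^ 3 + 4 / (107 / 100) ≤ 13.12 / a ^ 3 + 4 / a := by gcongr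
      refine le_trans ?_ this
      norm_num
    have h4 : 13 / s ≤ (13.12 / a ^ 3 + 4 / a) / s := by gcongr
    linarith
  refine le_trans ?_ hRHS
  change |_ - normalCDF z| ≤ _
  rcases lt_or_ge n 100 with hn | hn
  · have hs13 : s ≤ 10 := by
      rw [hs]
      apply Real.sqrt_le_iff.2
      have : (n : ℝ) < 100 := by exact_mod_cast hn
      constructor <;> norm_num
      linarith
    have h1 : 1 ≤ 13 / s := by rw [le_div_iff₀ hs0]; linarith
    have h2 := normalCDF_nonneg z
    have h3 := normalCDF_le_one z
    have h4 : (P {ω | ((V ω : ℝ) - n / 2) / σV ≤ z}).toReal ≤ 1 := measureReal_le_one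
    have h5 : 0 ≤ (P {ω | ((V ω : ℝ) - n / 2) / σV ≤ z}).toReal := ENNReal.toReal_nonneg
    rw [abs_le]
    constructor <;> linarith
  · set S : Set ℕ := {k | stdBinom n k ≤ z * a} with hS
    have hset : {ω | ((V ω : ℝ) - n / 2) / σV ≤ z} = {ω | V ω ∈ S} := by
      ext ω
      rw [Set.mem_ofPred_eq, Set.mem_ofPred_eq, hS, Set.mem_ofPred_eq, stdBinom, ← hs, ha,
        div_le_iff₀ hσpos, div_le_iff₀ hs0,
        show z * (2 * σV / s) * s = 2 * (z * σV) by field_simp]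
      constructor <;> intro h <;> linarith
    have h1 := prob_preimage_eq_card_div P V hV
      (fun v => (hdist v).trans (mixture_eq_card_div hm (by omega) fun e => numOn e = v)) S
    have h2 := abs_le.1 (abs_prob_numOn_sub_binomial_le hm hn S)
    have h3 := abs_le.1 (binomial_berry_esseen (by omega : n ≠ 0) (z * a))
    have h4 := abs_le.1 (abs_normalCDF_mul_sub_le ha_lo z)
    simp only [hS, Set.mem_ofPred_eq] at h2
    have h5 : 1 / (n : ℝ) ≤ 1 / s := by
      apply one_div_le_one_div_of_le hs0
      nlinarith
    have h6 : 13 / s = 3 / s + 8 / s + 2 * (1 / s) := by ring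
    rw [hset, h1, abs_le, h6]
    simp only [hS, Set.mem_ofPred_eq]
    rw [← hs] at h2 h3
    constructor <;> linarith [h2.1, h2.2, h3.1, h3.2, h4.1, h4.2]
end

section
/- Consider the lightbulb process on n bulbs with switch pattern 𝐬 = (s_1,…,s_k) and initial states X_{01} = ⋯ = X_{0α} = 0 and X_{0,α+1} = ⋯ = X_{0,α+β} = 1 (the initial states of the remaining bulbs being arbitrary), and let f_{α,β,𝐬} = P(X_1 = ⋯ = X_{α+β} = 0) be the probability that bulbs 1 through α+β are all off at the terminal time. Then, with b = α+β, f_{α,β,𝐬} = 2^{−b}·Σ_{j=0}^{b} C(b,j)·a_{α,β}(j)·λ_{n,j,𝐬}. -/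
open Finset

/-- The sequences `a_{α,β}`: `a_{α,0}(j) = 1`, and for `β ≥ 1`, with `b = α+β`,
`a_{α,β}(j) = ((b−j)/b)·a_{α,β−1}(j) − (j/b)·a_{α,β−1}(j−1)` (with `a_{α,β−1}(−1) = 0`,
which here is automatic since the coefficient `j/b` vanishes at `j = 0`). -/
noncomputable def aab : ℕ → ℕ → ℕ → ℝ
  | _, 0, _ => 1
  | α, β + 1, j =>
    (((α : ℝ) + β + 1 - j) / ((α : ℝ) + β + 1)) * aab α β j
      - ((j : ℝ) / ((α : ℝ) + β + 1)) * aab α β (j - 1)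

/-- Number of switch arrays for pattern `s` under which bulbs `1,…,α+β` all end up off,
when bulbs `1,…,α` start off and bulbs `α+1,…,α+β` start on. -/
def fCount (n k : ℕ) (s : Fin k → ℕ) (α β : ℕ) : ℕ :=
  ((validArrays n k s).filter (fun e => ∀ j : Fin n, (j : ℕ) < α + β →
    ((if (j : ℕ) < α then 0 else 1)
      + (Finset.univ.filter (fun r => e r j = true)).card) % 2 = 0)).card

/-- The sign `-1` of a switch that is on, `1` of a switch that is off. -/
def switchSign (b : Bool) : ℝ := if b = true then -1 else 1

theorem card_filter_powersetCard_superset {ι : Type*} [Fintype ι] [DecidableEq ι]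
    (U : Finset ι) (s : ℕ) (hU : U.card ≤ s) :
    ((powersetCard s univ).filter (fun S => U ⊆ S)).card
      = (Fintype.card ι - U.card).choose (s - U.card) := by
  rw [← card_compl, ← card_powersetCard]
  refine card_nbij' (fun S => S \ U) (fun S => S ∪ U) ?_ ?_ ?_ ?_
  · intro S hS
    simp only [coe_filter, mem_powersetCard, subset_univ, true_and, Set.mem_ofPred_eq] at hS
    simp only [mem_coe, mem_powersetCard]
    refine ⟨fun x hx => by simp_all, ?_⟩
    rw [card_sdiff_of_subset hS.2, hS.1]
  · intro S hS
    simp only [mem_coe, mem_powersetCard] at hS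
    simp only [coe_filter, mem_powersetCard, subset_univ, true_and, Set.mem_ofPred_eq,
      subset_union_right, and_true]
    rw [card_union_of_disjoint, hS.2, Nat.sub_add_cancel hU]
    exact subset_compl_iff_disjoint_right.mp hS.1
  · intro S hS
    simp only [coe_filter, mem_powersetCard, subset_univ, true_and, Set.mem_ofPred_eq] at hS
    exact sdiff_union_of_subset hS.2
  · intro S hS
    simp only [mem_coe, mem_powersetCard] at hS
    exact union_sdiff_cancel_right (subset_compl_iff_disjoint_right.mp hS.1)

theorem card_filter_superset_eq (n s t : ℕ) (U : Finset (Fin n)) (hU : U.card = t) :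
    ((((powersetCard s univ).filter (fun S => U ⊆ S)).card : ℕ) : ℝ)
      = (n.choose s : ℝ) * ((s.descFactorial t : ℝ) / (n.descFactorial t : ℝ)) := by
  subst hU
  have htn : U.card ≤ n := by simpa using card_le_univ U
  rcases le_or_gt U.card s with h | h
  · rw [card_filter_powersetCard_superset U s h, Fintype.card_fin]
    have h0 : (n.descFactorial U.card : ℝ) ≠ 0 := by
      exact_mod_cast (Nat.descFactorial_pos.mpr htn).ne'
    rw [← mul_div_assoc, eq_div_iff h0, Nat.descFactorial_eq_factorial_mul_choose,
      Nat.descFactorial_eq_factorial_mul_choose]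
    have hmul : (n.choose s : ℝ) * s.choose U.card
        = n.choose U.card * (n - U.card).choose (s - U.card) := by
      exact_mod_cast Nat.choose_mul h
    push_cast
    linear_combination (-(U.card.factorial : ℝ)) * hmul
  · rw [Nat.descFactorial_of_lt h]
    have : (powersetCard s univ).filter (fun S => U ⊆ S) = ∅ := by
      refine filter_eq_empty_iff.mpr fun S hS hUS => ?_
      have := card_le_card hUS
      rw [(mem_powersetCard.mp hS).2] at this
      omega
    simp [this]

/-- The switch vectors of one stage having exactly `s` switches. -/
def validStage (n s : ℕ) : Finset (Fin n → Bool) :=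
  univ.filter (fun x => (univ.filter (fun j => x j = true)).card = s)

theorem sum_validStage (n s : ℕ) (g : Finset (Fin n) → ℝ) :
    ∑ x ∈ validStage n s, g (univ.filter (fun j => x j = true))
      = ∑ S ∈ powersetCard s univ, g S := by
  refine sum_bij' (fun x _ => univ.filter (fun j => x j = true))
    (fun S _ j => decide (j ∈ S)) ?_ ?_ ?_ ?_ ?_
  · intro x hx
    simpa [validStage, mem_powersetCard] using hx
  · intro S hS
    simpa [validStage, mem_powersetCard] using hS
  · intro x hx
    ext j
    simp
  · intro S hS
    ext j
    simp
  · intro x hx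
    rfl

theorem card_validStage (n s : ℕ) : ((validStage n s).card : ℝ) = n.choose s := by
  have := sum_validStage n s (fun _ => 1)
  simpa using this

theorem sum_validStage_prod_switchSign (n s : ℕ) (T : Finset (Fin n)) :
    ∑ x ∈ validStage n s, ∏ j ∈ T, switchSign (x j)
      = (validStage n s).card * lam n T.card s := by
  have hexp : ∀ x : Fin n → Bool, ∏ j ∈ T, switchSign (x j)
      = ∑ U ∈ T.powerset,
        if U ⊆ univ.filter (fun j => x j = true) then (-2 : ℝ) ^ U.card else 0 := by
    intro x
    have : ∀ j, switchSign (x j) = 1 + (if x j = true then (-2 : ℝ) else 0) := by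
      intro j
      unfold switchSign
      split_ifs <;> norm_num
    simp_rw [this]
    rw [prod_one_add]
    refine sum_congr rfl fun U _ => ?_
    rw [prod_ite_zero, prod_const]
    simp [subset_iff]
  simp_rw [hexp]
  rw [sum_validStage n s
    (fun S => ∑ U ∈ T.powerset, if U ⊆ S then (-2 : ℝ) ^ U.card else 0), sum_comm]
  have hin : ∀ U ∈ T.powerset,
      (∑ S ∈ powersetCard s univ, if U ⊆ S then (-2 : ℝ) ^ U.card else 0)
        = (fun t : ℕ => (n.choose s : ℝ) *
          ((-2 : ℝ) ^ t * ((s.descFactorial t : ℝ) / (n.descFactorial t : ℝ)))) U.card := by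
    intro U _
    rw [← sum_filter, sum_const, nsmul_eq_mul, card_filter_superset_eq n s _ U rfl]
    ring
  rw [sum_congr rfl hin, sum_powerset_apply_card (fun t : ℕ => (n.choose s : ℝ) *
    ((-2 : ℝ) ^ t * ((s.descFactorial t : ℝ) / (n.descFactorial t : ℝ)))), card_validStage, lam, mul_sum]
  refine sum_congr rfl fun t _ => ?_
  rw [nsmul_eq_mul]
  ring

theorem validArrays_eq_piFinset (n k : ℕ) (s : Fin k → ℕ) :
    validArrays n k s = Fintype.piFinset (fun r => validStage n (s r)) := by
  ext e
  simp [validArrays, validStage]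

theorem sum_validArrays_prod_switchSign (n k : ℕ) (s : Fin k → ℕ) (T : Finset (Fin n)) :
    ∑ e ∈ validArrays n k s, ∏ j ∈ T, ∏ r, switchSign (e r j)
      = (validArrays n k s).card * ∏ r, lam n T.card (s r) := by
  rw [validArrays_eq_piFinset, Fintype.card_piFinset]
  push_cast
  rw [← prod_mul_distrib]
  simp_rw [← sum_validStage_prod_switchSign]
  rw [prod_univ_sum]
  exact sum_congr rfl fun e _ => prod_comm

theorem card_validArrays_ne_zero (n k : ℕ) (s : Fin k → ℕ) (hs : ∀ r, s r ≤ n) :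
    ((validArrays n k s).card : ℝ) ≠ 0 := by
  rw [validArrays_eq_piFinset, Fintype.card_piFinset]
  push_cast
  refine prod_ne_zero_iff.mpr fun r _ => ?_
  rw [card_validStage]
  exact_mod_cast (Nat.choose_pos (hs r)).ne'

/-- `C(b,j) a_{α,β}(j)` is the coefficient of `X^j` in `(1+X)^α (1-X)^β`, where `b = α+β`. -/
theorem choose_mul_aab (α β j : ℕ) :
    ((α + β).choose j : ℝ) * aab α β j
      = ((1 + Polynomial.X) ^ α * (1 - Polynomial.X) ^ β : Polynomial ℝ).coeff j := by
  induction β generalizing j with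
  | zero => simp [aab, Polynomial.coeff_one_add_X_pow]
  | succ β ih =>
    have hb : (α : ℝ) + β + 1 ≠ 0 := by positivity
    rw [pow_succ, ← mul_assoc, mul_sub, mul_one, Polynomial.coeff_sub, ← ih, aab, ← add_assoc]
    cases j with
    | zero => simp [hb]
    | succ j =>
      rw [Polynomial.coeff_mul_X, ← ih, Nat.add_sub_cancel]
      have h1 : ((α + β + 1).choose (j + 1) : ℝ) * (j + 1)
          = (α + β + 1) * (α + β).choose j := by
        exact_mod_cast (Nat.add_one_mul_choose_eq (α + β) j).symm
      have h2 : ((α + β + 1).choose (j + 1) : ℝ)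
          = (α + β).choose j + (α + β).choose (j + 1) := by
        exact_mod_cast Nat.choose_succ_succ (α + β) j
      push_cast
      field_simp
      linear_combination (-aab α β (j + 1) - aab α β j) * h1
        + aab α β (j + 1) * (α + β + 1) * h2

/-- The initial sign of a bulb: `1` for the first `α` bulbs, which start off, `-1` afterwards. -/
def initialSign (α j : ℕ) : ℝ := if j < α then 1 else -1

theorem prod_filter_lt {M : Type*} [CommMonoid M] (n b : ℕ) (hb : b ≤ n) (f : ℕ → M) :
    ∏ j ∈ univ.filter (fun j : Fin n => (j : ℕ) < b), f j = ∏ j ∈ range b, f j := by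
  refine prod_bij (fun j _ => (j : ℕ)) ?_ ?_ ?_ ?_
  · intro j hj
    simpa using hj
  · intro i _ j _ h
    exact Fin.ext h
  · intro j hj
    exact ⟨⟨j, by simp at hj; omega⟩, by simpa using hj, rfl⟩
  · intro j _
    rfl

theorem card_filter_lt (n b : ℕ) (hb : b ≤ n) :
    (univ.filter (fun j : Fin n => (j : ℕ) < b)).card = b := by
  have := prod_filter_lt n b hb (fun _ => Multiplicative.ofAdd 1)
  simpa [← ofAdd_nsmul] using this

theorem prod_one_add_initialSign_mul_X (n α β : ℕ) (hab : α + β ≤ n) :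
    ∏ j ∈ univ.filter (fun j : Fin n => (j : ℕ) < α + β),
        (1 + Polynomial.C (initialSign α j) * Polynomial.X)
      = ((1 + Polynomial.X) ^ α * (1 - Polynomial.X) ^ β : Polynomial ℝ) := by
  rw [prod_filter_lt n (α + β) hab
    (fun j => 1 + Polynomial.C (initialSign α j) * Polynomial.X), prod_range_add]
  congr 1
  · rw [prod_congr rfl (g := fun _ => 1 + Polynomial.X), prod_const, card_range]
    intro j hj
    simp [initialSign, mem_range.mp hj]
  · rw [prod_congr rfl (g := fun _ => 1 - Polynomial.X), prod_const, card_range]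
    intro j _
    simp [initialSign, sub_eq_add_neg]

theorem sum_powerset_prod_initialSign (n α β : ℕ) (hab : α + β ≤ n) (L : ℕ → ℝ) :
    ∑ T ∈ (univ.filter (fun j : Fin n => (j : ℕ) < α + β)).powerset,
        (∏ j ∈ T, initialSign α j) * L T.card
      = ∑ j ∈ range (α + β + 1), ((α + β).choose j : ℝ) * aab α β j * L j := by
  simp_rw [choose_mul_aab]
  rw [← prod_one_add_initialSign_mul_X n α β hab, prod_one_add]
  simp_rw [Polynomial.finsetSum_coeff, sum_mul]
  rw [sum_comm]
  refine sum_congr rfl fun T hT => ?_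
  have hcard : T.card < α + β + 1 := by
    have := card_le_card (mem_powerset.mp hT)
    rw [card_filter_lt n _ hab] at this
    omega
  simp_rw [prod_mul_distrib, prod_const, ← map_prod, Polynomial.coeff_C_mul_X_pow]
  simp [hcard]

theorem one_add_initialSign_mul_prod (k α j : ℕ) (x : Fin k → Bool) :
    1 + initialSign α j * ∏ r, switchSign (x r)
      = if ((if j < α then 0 else 1) + (univ.filter (fun r => x r = true)).card) % 2 = 0
        then 2 else 0 := by
  have h : ∏ r, switchSign (x r) = (-1 : ℝ) ^ (univ.filter (fun r => x r = true)).card := by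
    simp [switchSign, prod_ite]
  rw [h]
  unfold initialSign
  rcases Nat.even_or_odd (univ.filter (fun r => x r = true)).card with hc | hc
  · rw [hc.neg_one_pow]
    have := Nat.even_iff.mp hc
    by_cases hj : j < α
    · rw [if_pos hj, if_pos hj, if_pos (by omega)]
      norm_num
    · rw [if_neg hj, if_neg hj, if_neg (by omega)]
      norm_num
  · rw [hc.neg_one_pow]
    have := Nat.odd_iff.mp hc
    by_cases hj : j < α
    · rw [if_pos hj, if_pos hj, if_neg (by omega)]
      norm_num
    · rw [if_neg hj, if_neg hj, if_pos (by omega)]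
      norm_num

theorem two_pow_mul_fCount (n k : ℕ) (s : Fin k → ℕ) (α β : ℕ) (hab : α + β ≤ n) :
    (2 : ℝ) ^ (α + β) * fCount n k s α β
      = ∑ e ∈ validArrays n k s,
          ∏ j ∈ univ.filter (fun j : Fin n => (j : ℕ) < α + β),
            (1 + initialSign α j * ∏ r, switchSign (e r j)) := by
  simp_rw [one_add_initialSign_mul_prod, prod_ite_zero, prod_const, card_filter_lt n _ hab]
  rw [← sum_filter, sum_const, nsmul_eq_mul, mul_comm]
  simp [fCount]

/-- The probability `f_{α,β,𝐬}` that bulbs `1,…,α+β` all terminate off equals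
`2^{−b} ∑_{j=0}^{b} C(b,j) a_{α,β}(j) λ_{n,j,𝐬}` with `b = α+β`. -/
theorem lightbulb_off_probability (n k : ℕ) (hn : 0 < n) (s : Fin k → ℕ)
    (hs : ∀ r, s r ≤ n) (α β : ℕ) (hab : α + β ≤ n) :
    (fCount n k s α β : ℝ) / ((validArrays n k s).card : ℝ)
      = ((2 : ℝ) ^ (α + β))⁻¹ *
          ∑ j ∈ Finset.range (α + β + 1),
            ((α + β).choose j : ℝ) * aab α β j * ∏ r, lam n j (s r) := by
  rw [div_eq_iff (card_validArrays_ne_zero n k s hs), mul_assoc,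
    eq_inv_mul_iff_mul_eq₀ (by positivity), two_pow_mul_fCount n k s α β hab,
    ← sum_powerset_prod_initialSign n α β hab (fun j => ∏ r, lam n j (s r)), sum_mul]
  simp_rw [prod_one_add, prod_mul_distrib]
  rw [sum_comm]
  refine sum_congr rfl fun T _ => ?_
  rw [← mul_sum, sum_validArrays_prod_switchSign]
  ring
end
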